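/- arXiv:2012.00813 — 2 statements merged into one kernel-verified Lean document; each statement's English description precedes it below -/
import Mathlib

section
/- (Guthrie–Nymann–Saenz classification) For any sequence x : ℕ → ℝ of positive terms with Σ_{n≥1} x_n < ∞, the achievement set E(x) is either (1) homeomorphic to the Cantor ternary set, (2) a finite union of closed bounded intervals, or (3) homeomorphic to the Guthrie–Nymann set T = { Σ_{i≥1} ( ε_{2i−1}·(3/4^i) + ε_{2i}·(2/4^i) ) : ε_n ∈ {0,1} }. -/
/-- The achievement set (set of subsums) of a sequence `x`. -/
def achievementSet (x : ℕ → ℝ) : Set ℝ :=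
  {s : ℝ | ∃ ε : ℕ → ℝ, (∀ n, ε n = 0 ∨ ε n = 1) ∧ s = ∑' n, ε n * x n}

/-- `A` is a finite union of closed bounded intervals. -/
def IsFiniteUnionOfClosedIntervals (A : Set ℝ) : Prop :=
  ∃ s : Finset (ℝ × ℝ), A = ⋃ p ∈ s, Set.Icc p.1 p.2

/-- The Guthrie–Nymann set `T`. -/
def guthrieNymannSet : Set ℝ :=
  {s : ℝ | ∃ ε : ℕ → ℝ, (∀ n, ε n = 0 ∨ ε n = 1) ∧
    s = ∑' i : ℕ, (ε (2 * i) * (3 / 4 ^ (i + 1)) + ε (2 * i + 1) * (2 / 4 ^ (i + 1)))}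



theorem gn_backForth {α β : Type*} [DecidableEq α] [DecidableEq β] [Countable α] [Countable β]
    (Rel : α × β → α × β → Prop) (S0 : Finset (α × β))
    (h0 : ∀ p ∈ S0, ∀ q ∈ S0, Rel p q)
    (forth : ∀ S : Finset (α × β), S0 ⊆ S → (∀ p ∈ S, ∀ q ∈ S, Rel p q) →
      ∀ a, ∃ b, ∀ p ∈ insert (a, b) S, ∀ q ∈ insert (a, b) S, Rel p q)
    (back : ∀ S : Finset (α × β), S0 ⊆ S → (∀ p ∈ S, ∀ q ∈ S, Rel p q) →
      ∀ b, ∃ a, ∀ p ∈ insert (a, b) S, ∀ q ∈ insert (a, b) S, Rel p q) :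
    ∃ R : Set (α × β), ↑S0 ⊆ R ∧ (∀ p ∈ R, ∀ q ∈ R, Rel p q) ∧
      (∀ a, ∃ b, (a, b) ∈ R) ∧ (∀ b, ∃ a, (a, b) ∈ R) := by
  let P := {S : Finset (α × β) // S0 ⊆ S ∧ ∀ p ∈ S, ∀ q ∈ S, Rel p q}
  have := Encodable.ofCountable α
  have := Encodable.ofCountable β
  let D : α ⊕ β → Order.Cofinal P := fun x => match x with
    | Sum.inl a => 
      { carrier := {S | ∃ b, (a, b) ∈ S.1}
        isCofinal := by
          intro S
          obtain ⟨b, hb⟩ := forth S.1 S.2.1 S.2.2 a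
          exact ⟨⟨insert (a, b) S.1, S.2.1.trans (Finset.subset_insert _ _), hb⟩,
            ⟨b, Finset.mem_insert_self _ _⟩, Finset.subset_insert _ _⟩ }
    | Sum.inr b => 
      { carrier := {S | ∃ a, (a, b) ∈ S.1}
        isCofinal := by
          intro S
          obtain ⟨a, ha⟩ := back S.1 S.2.1 S.2.2 b
          exact ⟨⟨insert (a, b) S.1, S.2.1.trans (Finset.subset_insert _ _), ha⟩,
            ⟨a, Finset.mem_insert_self _ _⟩, Finset.subset_insert _ _⟩ }
  let p0 : P := ⟨S0, subset_rfl, h0⟩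
  let I := Order.idealOfCofinals p0 D
  refine ⟨{p | ∃ S ∈ I, p ∈ S.1}, ?_, ?_, ?_, ?_⟩
  · intro p hp
    exact ⟨p0, Order.mem_idealOfCofinals p0 D, hp⟩
  · rintro p ⟨S, hS, hp⟩ q ⟨T, hT, hq⟩
    obtain ⟨W, hW, hSW, hTW⟩ := I.directed _ hS _ hT
    exact W.2.2 p (hSW hp) q (hTW hq)
  · intro a
    obtain ⟨S, hS, hSI⟩ := Order.cofinal_meets_idealOfCofinals p0 D (Sum.inl a)
    obtain ⟨b, hb⟩ := hS
    exact ⟨b, S, hSI, hb⟩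
  · intro b
    obtain ⟨S, hS, hSI⟩ := Order.cofinal_meets_idealOfCofinals p0 D (Sum.inr b)
    obtain ⟨a, hb⟩ := hS
    exact ⟨a, S, hSI, hb⟩

structure GNColOrd {α : Type*} [LinearOrder α] (bo tp : α) (sim : α → α → Prop) (col : α → Prop)
    (C : Prop) : Prop where
  bot_le : ∀ x, bo ≤ x
  le_top : ∀ x, x ≤ tp
  refl : ∀ x, sim x x
  symm : ∀ x y, sim x y → sim y x
  trans : ∀ x y z, sim x y → sim y z → sim x z
  conv : ∀ x y z : α, x ≤ y → y ≤ z → sim x z → sim x y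
  col_sim : ∀ x y, sim x y → (col x ↔ col y)
  col_C : ∀ x, col x → C
  sim_dense : ∀ x y : α, x < y → ∃ w, x < w ∧ w < y
  near_left : ∀ x y : α, x < y → ¬ sim x y → ∃ w, x < w ∧ w < y ∧ sim x w
  near_right : ∀ x y : α, x < y → ¬ sim x y → ∃ w, x < w ∧ w < y ∧ sim w y
  mid_false : ∀ x y : α, x < y → ¬ sim x y → ∃ w, x < w ∧ w < y ∧ ¬ sim x w ∧ ¬ sim w y ∧ ¬ col w
  mid_true : C → ∀ x y : α, x < y → ¬ sim x y → ∃ w, x < w ∧ w < y ∧ ¬ sim x w ∧ ¬ sim w y ∧ col w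

def GNRel {α β : Type*} [LinearOrder α] [LinearOrder β] (sim : α → α → Prop) (col : α → Prop)
    (sim' : β → β → Prop) (col' : β → Prop) (p q : α × β) : Prop :=
  (p.1 < q.1 ↔ p.2 < q.2) ∧ (sim p.1 q.1 ↔ sim' p.2 q.2) ∧ (col p.1 ↔ col' p.2)

theorem gn_step {α β : Type*} [LinearOrder α] [LinearOrder β] {bo tp : α} {bo' tp' : β}
    {sim : α → α → Prop} {col : α → Prop} {sim' : β → β → Prop} {col' : β → Prop} {C : Prop}
    (hα : GNColOrd bo tp sim col C) (hβ : GNColOrd bo' tp' sim' col' C)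
    (S : Finset (α × β)) (hbo : (bo, bo') ∈ S) (hto : (tp, tp') ∈ S)
    (hS : ∀ p ∈ S, ∀ q ∈ S, GNRel sim col sim' col' p q) (a : α) :
    ∃ b, ∀ p ∈ insert (a, b) S, ∀ q ∈ insert (a, b) S, GNRel sim col sim' col' p q := by
  by_cases hdom : ∃ b, (a, b) ∈ S
  · obtain ⟨b, hb⟩ := hdom
    refine ⟨b, ?_⟩
    rw [Finset.insert_eq_of_mem hb]
    exact hS
  have hne : ∀ p ∈ S, p.1 ≠ a := by
    rintro ⟨p, p'⟩ hp rfl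
    exact hdom ⟨p', hp⟩
  obtain ⟨l, hl, hlmax⟩ := Finset.exists_max_image (S.filter (fun p => p.1 < a)) (fun p => p.1)
    ⟨(bo, bo'), by simp [hbo, lt_of_le_of_ne (hα.bot_le a) (hne _ hbo)]⟩
  obtain ⟨r, hr, hrmin⟩ := Finset.exists_min_image (S.filter (fun p => a < p.1)) (fun p => p.1)
    ⟨(tp, tp'), by simp [hto, lt_of_le_of_ne (hα.le_top a) (hne _ hto).symm]⟩
  simp only [Finset.mem_filter] at hl hr hlmax hrmin
  obtain ⟨hlS, hla⟩ := hl
  obtain ⟨hrS, har⟩ := hr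
  have hlr : l.1 < r.1 := hla.trans har
  have hlr' : l.2 < r.2 := (hS l hlS r hrS).1.1 hlr
  have hsimlr := (hS l hlS r hrS).2.1
  have hcl := (hS l hlS r hrS).2.2
  have hcr := (hS r hrS l hlS).2.2
  -- find b
  have key : ∃ b, l.2 < b ∧ b < r.2 ∧ (sim l.1 a ↔ sim' l.2 b) ∧ (sim a r.1 ↔ sim' b r.2) ∧
      (col a ↔ col' b) := by
    by_cases h1 : sim l.1 r.1
    · obtain ⟨b, hb1, hb2⟩ := hβ.sim_dense _ _ hlr'
      have h2 := hsimlr.1 h1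
      have e1 := hα.conv _ _ _ hla.le har.le h1
      have e2 := hβ.conv _ _ _ hb1.le hb2.le h2
      have e3 := hα.trans _ _ _ (hα.symm _ _ e1) h1
      have e4 := hβ.trans _ _ _ (hβ.symm _ _ e2) h2
      refine ⟨b, hb1, hb2, by simp [e1, e2], by simp [e3, e4], ?_⟩
      rw [← hα.col_sim _ _ e1, ← hβ.col_sim _ _ e2, hcl]
    · have h2 : ¬ sim' l.2 r.2 := fun h => h1 (hsimlr.2 h)
      by_cases h3 : sim l.1 a
      · obtain ⟨b, hb1, hb2, hb⟩ := hβ.near_left _ _ hlr' h2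
        have e3 : ¬ sim a r.1 := fun h => h1 (hα.trans _ _ _ h3 h)
        have e4 : ¬ sim' b r.2 := fun h => h2 (hβ.trans _ _ _ hb h)
        refine ⟨b, hb1, hb2, by simp [h3, hb], by simp [e3, e4], ?_⟩
        rw [← hα.col_sim _ _ h3, ← hβ.col_sim _ _ hb, hcl]
      · by_cases h4 : sim a r.1
        · obtain ⟨b, hb1, hb2, hb⟩ := hβ.near_right _ _ hlr' h2
          have e4 : ¬ sim' l.2 b := fun h => h2 (hβ.trans _ _ _ h hb)
          refine ⟨b, hb1, hb2, by simp [h3, e4], by simp [h4, hb], ?_⟩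
          rw [hα.col_sim _ _ h4, hβ.col_sim _ _ hb, hcr]
        · by_cases hc : col a
          · obtain ⟨b, hb1, hb2, hb3, hb4, hb5⟩ := hβ.mid_true (hα.col_C _ hc) _ _ hlr' h2
            exact ⟨b, hb1, hb2, by simp [*], by simp [*], by simp [*]⟩
          · obtain ⟨b, hb1, hb2, hb3, hb4, hb5⟩ := hβ.mid_false _ _ hlr' h2
            exact ⟨b, hb1, hb2, by simp [*], by simp [*], by simp [*]⟩
  obtain ⟨b, hlb, hbr, hsl, hsr, hcol⟩ := key
  refine ⟨b, ?_⟩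
  -- relation with other elements
  have main : ∀ s ∈ S, (s.1 < a ∧ s.2 < b ∨ a < s.1 ∧ b < s.2) ∧ (sim s.1 a ↔ sim' s.2 b) := by
    intro s hs
    rcases lt_or_gt_of_ne (hne s hs) with h | h
    · have h1 : s.1 ≤ l.1 := hlmax s ⟨hs, h⟩
      have h2 : s.2 ≤ l.2 := by
        by_contra hcon
        exact absurd ((hS l hlS s hs).1.2 (not_le.1 hcon)) (not_lt.2 h1)
      refine ⟨Or.inl ⟨h, h2.trans_lt hlb⟩, ?_⟩
      have h3 := (hS s hs l hlS).2.1
      constructor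
      · intro hh
        have e1 := hα.conv _ _ _ h1 hla.le hh
        have e2 := hα.trans _ _ _ (hα.symm _ _ e1) hh
        exact hβ.trans _ _ _ (h3.1 e1) (hsl.1 e2)
      · intro hh
        have e1 := hβ.conv _ _ _ h2 hlb.le hh
        have e2 := hβ.trans _ _ _ (hβ.symm _ _ e1) hh
        exact hα.trans _ _ _ (h3.2 e1) (hsl.2 e2)
    · have h1 : r.1 ≤ s.1 := hrmin s ⟨hs, h⟩
      have h2 : r.2 ≤ s.2 := by
        by_contra hcon
        exact absurd ((hS s hs r hrS).1.2 (not_le.1 hcon)) (not_lt.2 h1)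
      refine ⟨Or.inr ⟨h, hbr.trans_le h2⟩, ?_⟩
      have h3 := (hS r hrS s hs).2.1
      constructor
      · intro hh
        have hh := hα.symm _ _ hh
        have e1 := hα.conv _ _ _ har.le h1 hh
        have e2 := hα.trans _ _ _ (hα.symm _ _ e1) hh
        exact hβ.symm _ _ (hβ.trans _ _ _ (hsr.1 e1) (h3.1 e2))
      · intro hh
        have hh := hβ.symm _ _ hh
        have e1 := hβ.conv _ _ _ hbr.le h2 hh
        have e2 := hβ.trans _ _ _ (hβ.symm _ _ e1) hh
        exact hα.symm _ _ (hα.trans _ _ _ (hsr.2 e1) (h3.2 e2))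
  intro p hp q hq
  rw [Finset.mem_insert] at hp hq
  rcases hp with rfl | hp <;> rcases hq with rfl | hq
  · exact ⟨by simp, by simp [hα.refl, hβ.refl], hcol⟩
  · obtain ⟨h1, h2⟩ := main q hq
    refine ⟨?_, ⟨fun h => hβ.symm _ _ (h2.1 (hα.symm _ _ h)),
      fun h => hα.symm _ _ (h2.2 (hβ.symm _ _ h))⟩, hcol⟩
    rcases h1 with ⟨h3, h4⟩ | ⟨h3, h4⟩
    · simp [h3.not_gt, h4.not_gt]
    · simp [h3, h4]
  · obtain ⟨h1, h2⟩ := main p hp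
    refine ⟨?_, h2, (hS p hp p hp).2.2⟩
    rcases h1 with ⟨h3, h4⟩ | ⟨h3, h4⟩
    · simp [h3, h4]
    · simp [h3.not_gt, h4.not_gt]
  · exact hS p hp q hq

theorem gn_iso {α β : Type*} [LinearOrder α] [LinearOrder β] [Countable α] [Countable β]
    {bo tp : α} {bo' tp' : β}
    {sim : α → α → Prop} {col : α → Prop} {sim' : β → β → Prop} {col' : β → Prop} {C : Prop}
    (hα : GNColOrd bo tp sim col C) (hβ : GNColOrd bo' tp' sim' col' C)
    (h0 : ∀ p ∈ ({(bo, bo'), (tp, tp')} : Set (α × β)),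
      ∀ q ∈ ({(bo, bo'), (tp, tp')} : Set (α × β)), GNRel sim col sim' col' p q) :
    ∃ R : Set (α × β), (bo, bo') ∈ R ∧ (tp, tp') ∈ R ∧
      (∀ p ∈ R, ∀ q ∈ R, GNRel sim col sim' col' p q) ∧
      (∀ a, ∃ b, (a, b) ∈ R) ∧ (∀ b, ∃ a, (a, b) ∈ R) := by
  obtain ⟨R, h1, h2, h3, h4⟩ := gn_backForth (GNRel sim col sim' col') {(bo, bo'), (tp, tp')}
    (by simpa using h0)
    (fun S hS hg a => gn_step hα hβ S (hS (by simp)) (hS (by simp)) hg a)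
    (by
      intro S hS hg b
      have hb1 : (bo, bo') ∈ S := hS (by simp)
      have hb2 : (tp, tp') ∈ S := hS (by simp)
      have flip : ∀ p q : α × β, GNRel sim col sim' col' p q ↔
          GNRel sim' col' sim col p.swap q.swap := by
        intro p q
        simp only [GNRel, Prod.fst_swap, Prod.snd_swap]
        tauto
      obtain ⟨a, ha⟩ := gn_step hβ hα (S.image Prod.swap)
        (Finset.mem_image.2 ⟨_, hb1, rfl⟩) (Finset.mem_image.2 ⟨_, hb2, rfl⟩)
        (by
          intro p hp q hq
          obtain ⟨p, hp', rfl⟩ := Finset.mem_image.1 hp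
          obtain ⟨q, hq', rfl⟩ := Finset.mem_image.1 hq
          exact (flip p q).1 (hg p hp' q hq')) b
      refine ⟨a, fun p hp q hq => (flip p q).2 (ha _ ?_ _ ?_)⟩
      · rw [Finset.mem_insert] at hp ⊢
        rcases hp with rfl | hp
        · exact Or.inl rfl
        · exact Or.inr (Finset.mem_image.2 ⟨_, hp, rfl⟩)
      · rw [Finset.mem_insert] at hq ⊢
        rcases hq with rfl | hq
        · exact Or.inl rfl
        · exact Or.inr (Finset.mem_image.2 ⟨_, hq, rfl⟩))
  exact ⟨R, h1 (by simp), h1 (by simp), h2, h3, h4⟩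


/-- monotone extension of a relation between dense sets -/
theorem gn_ext_aux (R : Set (ℝ × ℝ)) (A B A' B' : ℝ)
    (hA : (A, A') ∈ R) (hB : (B, B') ∈ R)
    (hbd : ∀ p ∈ R, p.2 ∈ Set.Icc A' B')
    (hlt : ∀ p ∈ R, ∀ q ∈ R, (p.1 < q.1 ↔ p.2 < q.2))
    (hd : ∀ s t, A ≤ s → s < t → t ≤ B → ∃ p ∈ R, s < p.1 ∧ p.1 < t) :
    ∃ h : ℝ → ℝ, ∀ t ∈ Set.Icc A B, h t ∈ Set.Icc A' B' ∧
      ∀ p ∈ R, p.1 ∈ Set.Icc A B → (p.1 < t → p.2 < h t) ∧ (t < p.1 → h t < p.2) := by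
  refine ⟨fun t => sSup {y | ∃ p ∈ R, p.1 ≤ t ∧ y = p.2}, ?_⟩
  intro t ht
  have hne : {y | ∃ p ∈ R, p.1 ≤ t ∧ y = p.2}.Nonempty := ⟨A', (A, A'), hA, ht.1, rfl⟩
  have hba : BddAbove {y | ∃ p ∈ R, p.1 ≤ t ∧ y = p.2} := by
    refine ⟨B', ?_⟩
    rintro y ⟨p, hp, -, rfl⟩
    exact (hbd p hp).2
  have hle : ∀ p ∈ R, p.1 ≤ t → p.2 ≤ sSup {y | ∃ p ∈ R, p.1 ≤ t ∧ y = p.2} :=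
    fun p hp hpt => le_csSup hba ⟨p, hp, hpt, rfl⟩
  have hge : ∀ p ∈ R, t < p.1 → sSup {y | ∃ p ∈ R, p.1 ≤ t ∧ y = p.2} ≤ p.2 := by
    intro p hp hpt
    refine csSup_le hne ?_
    rintro y ⟨q, hq, hqt, rfl⟩
    exact ((hlt q hq p hp).1 (hqt.trans_lt hpt)).le
  refine ⟨⟨hle (A, A') hA ht.1, csSup_le hne ?_⟩, ?_⟩
  · rintro y ⟨q, hq, hqt, rfl⟩
    exact (hbd q hq).2
  · intro p hp hpI
    constructor
    · intro h
      obtain ⟨q, hq, h1, h2⟩ := hd p.1 t hpI.1 h ht.2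
      exact ((hlt p hp q hq).1 h1).trans_le (hle q hq h2.le)
    · intro h
      obtain ⟨q, hq, h1, h2⟩ := hd t p.1 ht.1 h hpI.2
      exact (hge q hq h1).trans_lt ((hlt q hq p hp).1 h2)

theorem gn_extend (R : Set (ℝ × ℝ)) (A B A' B' : ℝ)
    (hA : (A, A') ∈ R) (hB : (B, B') ∈ R)
    (hbd1 : ∀ p ∈ R, p.1 ∈ Set.Icc A B)
    (hbd2 : ∀ p ∈ R, p.2 ∈ Set.Icc A' B')
    (hlt : ∀ p ∈ R, ∀ q ∈ R, (p.1 < q.1 ↔ p.2 < q.2))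
    (hd1 : ∀ s t, A ≤ s → s < t → t ≤ B → ∃ p ∈ R, s < p.1 ∧ p.1 < t)
    (hd2 : ∀ s t, A' ≤ s → s < t → t ≤ B' → ∃ p ∈ R, s < p.2 ∧ p.2 < t) :
    ∃ h : Set.Icc A B ≃ₜ Set.Icc A' B', 
      ∀ t : Set.Icc A B, ∀ p ∈ R, (p.1 < (t : ℝ) ↔ p.2 < (h t : ℝ)) ∧ ((t : ℝ) < p.1 ↔ (h t : ℝ) < p.2) := by
  obtain ⟨h, hh⟩ := gn_ext_aux R A B A' B' hA hB hbd2 hlt hd1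
  obtain ⟨g, hg⟩ := gn_ext_aux (Prod.swap '' R) A' B' A B ⟨_, hA, rfl⟩ ⟨_, hB, rfl⟩
    (by rintro _ ⟨p, hp, rfl⟩; exact hbd1 p hp)
    (by rintro _ ⟨p, hp, rfl⟩ _ ⟨q, hq, rfl⟩; exact (hlt p hp q hq).symm)
    (by
      intro s t h1 h2 h3
      obtain ⟨p, hp, h4⟩ := hd2 s t h1 h2 h3
      exact ⟨_, ⟨p, hp, rfl⟩, h4⟩)
  have hg' : ∀ t ∈ Set.Icc A' B', g t ∈ Set.Icc A B ∧
      ∀ p ∈ R, (p.2 < t → p.1 < g t) ∧ (t < p.2 → g t < p.1) := by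
    intro t ht
    refine ⟨(hg t ht).1, fun p hp => (hg t ht).2 p.swap ⟨p, hp, rfl⟩ (hbd2 p hp)⟩
  have hgh : ∀ t ∈ Set.Icc A B, g (h t) = t := by
    intro t ht
    obtain ⟨h1, h2⟩ := hh t ht
    obtain ⟨h3, h4⟩ := hg' _ h1
    rcases lt_trichotomy (g (h t)) t with hlt | heq | hgt
    · obtain ⟨p, hp, h5, h6⟩ := hd1 _ _ h3.1 hlt ht.2
      exact absurd ((h4 p hp).1 ((h2 p hp (hbd1 p hp)).1 h6)) h5.not_gt
    · exact heq
    · obtain ⟨p, hp, h5, h6⟩ := hd1 _ _ ht.1 hgt h3.2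
      exact absurd ((h4 p hp).2 ((h2 p hp (hbd1 p hp)).2 h5)) h6.not_gt
  have hhg : ∀ t ∈ Set.Icc A' B', h (g t) = t := by
    intro t ht
    obtain ⟨h1, h2⟩ := hg' t ht
    obtain ⟨h3, h4⟩ := hh _ h1
    rcases lt_trichotomy (h (g t)) t with hlt | heq | hgt
    · obtain ⟨p, hp, h5, h6⟩ := hd2 _ _ h3.1 hlt ht.2
      exact absurd ((h4 p hp (hbd1 p hp)).1 ((h2 p hp).1 h6)) h5.not_gt
    · exact heq
    · obtain ⟨p, hp, h5, h6⟩ := hd2 _ _ ht.1 hgt h3.2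
      exact absurd ((h4 p hp (hbd1 p hp)).2 ((h2 p hp).2 h5)) h6.not_gt
  let e : Set.Icc A B ≃ Set.Icc A' B' :=
    { toFun := fun t => ⟨h t, (hh t t.2).1⟩
      invFun := fun t => ⟨g t, (hg' t t.2).1⟩
      left_inv := fun t => Subtype.ext (hgh t t.2)
      right_inv := fun t => Subtype.ext (hhg t t.2) }
  have hmono : StrictMono e := by
    intro s t hst
    obtain ⟨p, hp, h5, h6⟩ := hd1 s t s.2.1 hst t.2.2
    exact (((hh s s.2).2 p hp (hbd1 p hp)).2 h5).trans (((hh t t.2).2 p hp (hbd1 p hp)).1 h6)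
  let o : Set.Icc A B ≃o Set.Icc A' B' := ⟨e, hmono.le_iff_le⟩
  refine ⟨o.toHomeomorph, ?_⟩
  intro t p hp
  change (p.1 < (t : ℝ) ↔ p.2 < h t) ∧ ((t : ℝ) < p.1 ↔ h t < p.2)
  have h1 := ((hh t t.2).2 p hp (hbd1 p hp))
  have h2 := (hg' (h t) (hh t t.2).1).2 p hp
  rw [hgh t t.2] at h2
  exact ⟨⟨h1.1, h2.1⟩, ⟨h1.2, h2.2⟩⟩

theorem gn_precon {E t : Set ℝ} (ht : IsPreconnected t) (hK : ∀ k ∈ t, k ∉ frontier E)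
    {u v : ℝ} (hu : u ∈ t) (hv : v ∈ t) (hvE : u ∈ E) : v ∈ E := by
  have h1 : t ⊆ interior E ∪ (closure E)ᶜ := by
    intro k hk
    by_cases h : k ∈ interior E
    · exact Or.inl h
    · exact Or.inr fun h' => hK k hk ⟨h', h⟩
  have h2 : t ⊆ interior E := by
    refine ht.subset_left_of_subset_union isOpen_interior isClosed_closure.isOpen_compl ?_ h1 ?_
    · exact disjoint_compl_right.mono_left (interior_subset.trans subset_closure)
    · refine ⟨u, hu, ?_⟩
      rcases h1 hu with h | h
      · exact h
      · exact absurd (subset_closure hvE) h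
  exact interior_subset (h2 hv)

/-- right-end condition -/
def GNRight (E : Set ℝ) : Prop :=
  ∀ p q, p < q → q ∈ E → (∀ y, p < y → y < q → y ∉ E) → ∀ d, q < d →
    (∃ y, q < y ∧ y < d ∧ y ∉ E) ∧ (∃ y, q < y ∧ y < d ∧ y ∈ E) ∧
    ((interior E).Nonempty → ∃ y, q < y ∧ y < d ∧ y ∈ interior E)

structure GNGood (E : Set ℝ) : Prop where
  cpt : IsCompact E
  right : GNRight E
  left : GNRight (-E)

theorem gn_mid_right {E : Set ℝ} (hE : IsClosed E) (hR : GNRight E) {u v : ℝ} (hu : u ∉ E)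
    (huv : u < v) (hv : v ∉ frontier E) (hk : ∃ k ∈ E, u < k ∧ k ≤ v) :
    (∃ w e₁ e₂, w ∉ E ∧ e₁ ∈ E ∧ e₂ ∈ E ∧ u ≤ e₁ ∧ e₁ < w ∧ w < e₂ ∧ e₂ ≤ v) ∧
    ((interior E).Nonempty → ∃ z y₁ y₂, z ∈ interior E ∧ y₁ ∉ E ∧ y₂ ∉ E ∧ u ≤ y₁ ∧ y₁ < z ∧ z < y₂
      ∧ y₂ ≤ v) := by
  obtain ⟨k, hkE, hk1, hk2⟩ := hk
  have hcl : IsClosed (E ∩ Set.Icc u v) := hE.inter isClosed_Icc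
  have hne : (E ∩ Set.Icc u v).Nonempty := ⟨k, hkE, hk1.le, hk2⟩
  have hbb : BddBelow (E ∩ Set.Icc u v) := ⟨u, fun y hy => hy.2.1⟩
  set q := sInf (E ∩ Set.Icc u v) with hq
  have hqm : q ∈ E ∩ Set.Icc u v := hcl.csInf_mem hne hbb
  have huq : u < q := lt_of_le_of_ne hqm.2.1 (fun h => hu (h ▸ hqm.1))
  have hgap : ∀ y, u < y → y < q → y ∉ E := by
    intro y h1 h2 h3
    exact absurd (csInf_le hbb ⟨h3, h1.le, h2.le.trans hqm.2.2⟩) (not_le.2 h2)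
  have hqv : q < v := by
    refine lt_of_le_of_ne hqm.2.2 fun h => hv ?_
    rw [← h]
    refine ⟨subset_closure hqm.1, fun hi => ?_⟩
    rw [mem_interior_iff_mem_nhds, mem_nhds_iff_exists_Ioo_subset] at hi
    obtain ⟨l, r, hlr, hs⟩ := hi
    obtain ⟨y, hy1, hy2⟩ := exists_between (max_lt hlr.1 huq)
    exact hgap y ((le_max_right _ _).trans_lt hy1) hy2
      (hs ⟨(le_max_left _ _).trans_lt hy1, hy2.trans hlr.2⟩)
  have H := hR u q huq hqm.1 hgap
  constructor
  · obtain ⟨e₂, h1, h2, h3⟩ := (H v hqv).2.1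
    obtain ⟨w, h4, h5, h6⟩ := (H e₂ h1).1
    exact ⟨w, q, e₂, h6, hqm.1, h3, huq.le, h4, h5, h2.le⟩
  · intro hi
    obtain ⟨y, h1, h2, h3⟩ := (H v hqv).1
    obtain ⟨z, h4, h5, h6⟩ := (H y h1).2.2 hi
    exact ⟨z, u, y, h6, hu, h3, le_rfl, huq.trans h4, h5, h2.le⟩

theorem gn_mid {E : Set ℝ} (hE : GNGood E) {u v : ℝ} (hu : u ∉ frontier E)
    (huv : u < v) (hv : v ∉ frontier E) (hk : ∃ k ∈ frontier E, u ≤ k ∧ k ≤ v) :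
    (∃ w e₁ e₂, w ∉ E ∧ e₁ ∈ E ∧ e₂ ∈ E ∧ u ≤ e₁ ∧ e₁ < w ∧ w < e₂ ∧ e₂ ≤ v) ∧
    ((interior E).Nonempty → ∃ z y₁ y₂, z ∈ interior E ∧ y₁ ∉ E ∧ y₂ ∉ E ∧ u ≤ y₁ ∧ y₁ < z ∧ z < y₂
      ∧ y₂ ≤ v) := by
  have hcl : IsClosed E := hE.cpt.isClosed
  obtain ⟨k, hkK, hk1, hk2⟩ := hk
  have hkE : k ∈ E := hcl.frontier_subset hkK
  have hk1' : u < k := lt_of_le_of_ne hk1 (fun h => hu (h ▸ hkK))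
  have hk2' : k < v := lt_of_le_of_ne hk2 (fun h => hv (h ▸ hkK))
  by_cases huE : u ∈ E
  · by_cases hvE : v ∈ E
    · have : ∃ w, w ∉ E ∧ u < w ∧ w < v := by
        have h1 := hkK.2
        by_contra hcon
        push Not at hcon
        apply h1
        rw [mem_interior_iff_mem_nhds]
        filter_upwards [Ioo_mem_nhds hk1' hk2'] with y hy
        by_contra hyE
        exact absurd hy.2 (not_lt.2 (hcon y hyE hy.1))
      obtain ⟨w, hw, hw1, hw2⟩ := this
      refine ⟨⟨w, u, v, hw, huE, hvE, le_rfl, hw1, hw2, le_rfl⟩, fun hi => ?_⟩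
      obtain ⟨z, y₁, y₂, h1, h2, h3, h4, h5⟩ :=
        (gn_mid_right hcl hE.right hw hw2 hv ⟨v, hvE, hw2, le_rfl⟩).2 hi
      exact ⟨z, y₁, y₂, h1, h2, h3, hw1.le.trans h4, h5⟩
    · have hint : interior (-E) = - interior E := by
        have := (Homeomorph.neg ℝ).preimage_interior E
        simpa using this.symm
      have hfr : frontier (-E) = - frontier E := by
        have := (Homeomorph.neg ℝ).preimage_frontier E
        simpa using this.symm
      have := gn_mid_right (E := -E) (u := -v) (v := -u) hcl.neg hE.left (by simpa using hvE)
        (by linarith) (by rw [hfr]; simpa using hu) ⟨-k, by simpa using hkE, by linarith, by linarith⟩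
      obtain ⟨⟨w, e₁, e₂, h1, h2, h3, h4, h5, h6, h7⟩, H⟩ := this
      refine ⟨⟨-w, -e₂, -e₁, h1, h3, h2, by linarith, by linarith, by linarith, by linarith⟩, ?_⟩
      intro hi
      rw [hint] at H
      obtain ⟨w, e₁, e₂, h1, h2, h3, h4, h5, h6, h7⟩ := H (by simpa using hi)
      exact ⟨-w, -e₂, -e₁, h1, h3, h2, by linarith, by linarith, by linarith, by linarith⟩
  · exact gn_mid_right hcl hE.right huE huv hv ⟨k, hkE, hk1', hk2⟩


def GNQ (E : Set ℝ) (A B : ℝ) : Set ℝ :=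
  {x | x ∈ Set.Icc A B ∧ x ∉ frontier E ∧ (x = A ∨ x = B ∨ ∃ r : ℚ, (r : ℝ) = x)}

def GNSim (E : Set ℝ) (u v : ℝ) : Prop := ∀ k ∈ Set.uIcc u v, k ∉ frontier E

theorem gn_Q_countable (E : Set ℝ) (A B : ℝ) : (GNQ E A B).Countable := by
  refine Set.Countable.mono ?_ ((Set.countable_singleton A).union
    ((Set.countable_singleton B).union (Set.countable_range (fun r : ℚ => (r : ℝ)))))
  rintro x ⟨-, -, h⟩
  rcases h with h | h | h
  · exact Or.inl h
  · exact Or.inr (Or.inl h)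
  · exact Or.inr (Or.inr h)

theorem gn_Q_dense {E : Set ℝ} (hE : IsClosed E) {A B s t : ℝ} (hs : A ≤ s) (hst : s < t)
    (ht : t ≤ B) : ∃ x ∈ GNQ E A B, s < x ∧ x < t := by
  have h1 : ∃ y ∈ Set.Ioo s t, y ∉ frontier E := by
    by_contra hcon
    push Not at hcon
    have h2 : Set.Ioo s t ⊆ interior (frontier E) := interior_maximal hcon isOpen_Ioo
    rw [interior_frontier hE] at h2
    obtain ⟨y, hy⟩ := exists_between hst
    exact h2 hy
  have h3 : (Set.Ioo s t ∩ (frontier E)ᶜ).Nonempty := h1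
  have h4 : IsOpen (Set.Ioo s t ∩ (frontier E)ᶜ) := isOpen_Ioo.inter isClosed_frontier.isOpen_compl
  obtain ⟨x, hx, r, rfl⟩ := (Rat.denseRange_cast (𝕜 := ℝ)).inter_open_nonempty _ h4 h3
  exact ⟨r, ⟨⟨hs.trans hx.1.1.le, hx.1.2.le.trans ht⟩, hx.2, Or.inr (Or.inr ⟨r, rfl⟩)⟩, hx.1.1, hx.1.2⟩

/-- points of Q in open sets -/
theorem gn_Q_open {E : Set ℝ} (hE : IsClosed E) {A B s t w : ℝ} (hs : A ≤ s) 
    (ht : t ≤ B) {O : Set ℝ} (hO : IsOpen O) (hw : w ∈ O) (hsw : s < w) (hwt : w < t) :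
    ∃ x ∈ GNQ E A B, s < x ∧ x < t ∧ x ∈ O := by
  obtain ⟨l, r, h1, h2⟩ := mem_nhds_iff_exists_Ioo_subset.1 (hO.mem_nhds hw)
  have h3 : max l s < w := max_lt h1.1 hsw
  have h4 : w < min r t := lt_min h1.2 hwt
  obtain ⟨x, hx, h5, h6⟩ := gn_Q_dense hE (A := A) (B := B) (hs.trans (le_max_right l s))
    (h3.trans h4) ((min_le_right r t).trans ht)
  have h7 := max_lt_iff.1 h5
  have h8 := lt_min_iff.1 h6
  exact ⟨x, hx, h7.2, h8.2, h2 ⟨h7.1, h8.1⟩⟩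

theorem gn_not_sim {E : Set ℝ} {u v e y : ℝ} (he : e ∈ Set.uIcc u v) (hy : y ∈ Set.uIcc u v)
    (heE : e ∈ E) (hyE : y ∉ E) : ¬ GNSim E u v := fun h =>
  hyE (gn_precon isPreconnected_uIcc h he hy heE)

theorem gn_colOrd {E : Set ℝ} (hE : GNGood E) {A B : ℝ} 
    (hA : A ∈ GNQ E A B) (hB : B ∈ GNQ E A B) :
    GNColOrd (α := GNQ E A B) ⟨A, hA⟩ ⟨B, hB⟩ (fun u v => GNSim E u v) (fun u => (u : ℝ) ∈ E)
      (interior E).Nonempty := by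
  have hcl := hE.cpt.isClosed
  have hfc : IsClosed (frontier E) := isClosed_frontier
  have hns : ∀ u v : ℝ, u < v → ¬ GNSim E u v → ∃ k ∈ frontier E, u ≤ k ∧ k ≤ v := by
    intro u v huv h
    unfold GNSim at h
    push Not at h
    obtain ⟨k, h1, h2⟩ := h
    rw [Set.uIcc_of_le huv.le] at h1
    exact ⟨k, h2, h1.1, h1.2⟩
  refine
    { bot_le := fun x => x.2.1.1
      le_top := fun x => x.2.1.2
      refl := ?_
      symm := ?_
      trans := ?_
      conv := ?_
      col_sim := ?_
      col_C := ?_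
      sim_dense := ?_
      near_left := ?_
      near_right := ?_
      mid_false := ?_
      mid_true := ?_ }
  · intro x k hk
    simp only [Set.uIcc_self, Set.mem_singleton_iff] at hk
    rw [hk]; exact x.2.2.1
  · intro x y h k hk
    exact h k (by rwa [Set.uIcc_comm])
  · intro x y z h1 h2 k hk
    rcases Set.uIcc_subset_uIcc_union_uIcc (b := (y : ℝ)) hk with h | h
    · exact h1 k h
    · exact h2 k h
  · intro x y z h1 h2 h k hk
    refine h k ?_
    rw [Set.uIcc_of_le (show (x : ℝ) ≤ y from h1)] at hk
    rw [Set.uIcc_of_le (show (x : ℝ) ≤ z from h1.trans h2)]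
    exact ⟨hk.1, hk.2.trans h2⟩
  · intro x y h
    exact ⟨fun hx => gn_precon isPreconnected_uIcc h Set.left_mem_uIcc Set.right_mem_uIcc hx,
      fun hx => gn_precon isPreconnected_uIcc h Set.right_mem_uIcc Set.left_mem_uIcc hx⟩
  · intro x hx
    refine ⟨x, ?_⟩
    by_contra h
    exact x.2.2.1 ⟨subset_closure hx, h⟩
  · intro x y h
    obtain ⟨w, hw, h1, h2⟩ := gn_Q_dense hcl x.2.1.1 h y.2.1.2
    exact ⟨⟨w, hw⟩, h1, h2⟩
  · intro x y hxy h
    obtain ⟨l, r, h1, h2⟩ := mem_nhds_iff_exists_Ioo_subset.1 (hfc.isOpen_compl.mem_nhds x.2.2.1)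
    obtain ⟨w, hw, h3, h4⟩ := gn_Q_dense hcl x.2.1.1 (lt_min h1.2 hxy) ((min_le_right _ _).trans y.2.1.2)
    have h5 := lt_min_iff.1 h4
    refine ⟨⟨w, hw⟩, h3, h5.2, ?_⟩
    intro k hk
    rw [Set.uIcc_of_le h3.le] at hk
    exact h2 ⟨h1.1.trans_le hk.1, hk.2.trans_lt h5.1⟩
  · intro x y hxy h
    obtain ⟨l, r, h1, h2⟩ := mem_nhds_iff_exists_Ioo_subset.1 (hfc.isOpen_compl.mem_nhds y.2.2.1)
    obtain ⟨w, hw, h3, h4⟩ := gn_Q_dense hcl (x.2.1.1.trans (le_max_right l _)) (max_lt h1.1 hxy) y.2.1.2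
    have h5 := max_lt_iff.1 h3
    refine ⟨⟨w, hw⟩, h5.2, h4, ?_⟩
    intro k hk
    rw [Set.uIcc_of_le h4.le] at hk
    exact h2 ⟨h5.1.trans_le hk.1, hk.2.trans_lt h1.2⟩
  · intro x y hxy h
    obtain ⟨w, e₁, e₂, h1, h2, h3, h4, h5, h6, h7⟩ :=
      (gn_mid hE x.2.2.1 hxy y.2.2.1 (hns x y hxy h)).1
    obtain ⟨w', hw', h8, h9, h10⟩ := gn_Q_open hcl (x.2.1.1.trans h4) (h7.trans y.2.1.2)
      hcl.isOpen_compl h1 h5 h6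
    have h11 : (x : ℝ) < w' := h4.trans_lt h8
    have h12 : w' < (y : ℝ) := h9.trans_le h7
    refine ⟨⟨w', hw'⟩, h11, h12, gn_not_sim (e := e₁) (y := w') ?_ ?_ h2 h10,
      gn_not_sim (e := e₂) (y := w') ?_ ?_ h3 h10, h10⟩
    · rw [Set.uIcc_of_le h11.le]; exact ⟨h4, h8.le⟩
    · exact Set.right_mem_uIcc
    · rw [Set.uIcc_of_le h12.le]; exact ⟨h9.le, h7⟩
    · exact Set.left_mem_uIcc
  · intro hi x y hxy h
    obtain ⟨w, e₁, e₂, h1, h2, h3, h4, h5, h6, h7⟩ :=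
      (gn_mid hE x.2.2.1 hxy y.2.2.1 (hns x y hxy h)).2 hi
    obtain ⟨w', hw', h8, h9, h10⟩ := gn_Q_open hcl (x.2.1.1.trans h4) (h7.trans y.2.1.2)
      isOpen_interior h1 h5 h6
    have h11 : (x : ℝ) < w' := h4.trans_lt h8
    have h12 : w' < (y : ℝ) := h9.trans_le h7
    have h10 := interior_subset h10
    refine ⟨⟨w', hw'⟩, h11, h12, gn_not_sim (y := e₁) (e := w') ?_ ?_ h10 h2,
      gn_not_sim (y := e₂) (e := w') ?_ ?_ h10 h3, h10⟩
    · exact Set.right_mem_uIcc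
    · rw [Set.uIcc_of_le h11.le]; exact ⟨h4, h8.le⟩
    · exact Set.left_mem_uIcc
    · rw [Set.uIcc_of_le h12.le]; exact ⟨h9.le, h7⟩

theorem gn_bounds {E : Set ℝ} (hE : GNGood E) : ∃ A B, A < B ∧ E ⊆ Set.Ioo A B := by
  obtain ⟨a, ha⟩ := hE.cpt.bddBelow
  obtain ⟨b, hb⟩ := hE.cpt.bddAbove
  refine ⟨min a b - 1, max a b + 1, ?_, fun x hx => ⟨?_, ?_⟩⟩
  · have := min_le_max (a := a) (b := b); linarith
  · have := ha hx; have := min_le_left a b; linarith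
  · have := hb hx; have := le_max_right a b; linarith

theorem gn_notE_preserve {E E' : Set ℝ} (hE' : IsClosed E') {A B A' B' : ℝ} 
    (R : Set (ℝ × ℝ)) (f : ℝ → ℝ)
    (hR2 : ∀ y ∈ GNQ E' A' B', ∃ x, (x, y) ∈ R)
    (hAR : (A, A') ∈ R) (hBR : (B, B') ∈ R)
    (hsim : ∀ p ∈ R, ∀ q ∈ R, GNSim E' p.2 q.2 → GNSim E p.1 q.1)
    (hcol : ∀ p ∈ R, p.2 ∉ E' → p.1 ∉ E)
    (hE : E ⊆ Set.Ioo A B)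
    {t : ℝ} (hf : ∀ p ∈ R, (p.1 < t ↔ p.2 < f t) ∧ (t < p.1 ↔ f t < p.2)) (ht : t ∈ E) : f t ∈ E' := by
  by_contra hcon
  have h1 : A' < f t := (hf _ hAR).1.1 (hE ht).1
  have h2 : f t < B' := (hf _ hBR).2.1 (hE ht).2
  obtain ⟨l, r, h3, h4⟩ := mem_nhds_iff_exists_Ioo_subset.1 (hE'.isOpen_compl.mem_nhds hcon)
  obtain ⟨u, hu, h5, h6⟩ := gn_Q_dense hE' (le_max_right l A') (max_lt h3.1 h1) h2.le
  obtain ⟨v, hv, h7, h8⟩ := gn_Q_dense hE' h1.le (lt_min h3.2 h2) (min_le_right r B')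
  have h5 := (max_lt_iff.1 h5).1
  have h8 := (lt_min_iff.1 h8).1
  have huv : u < v := h6.trans h7
  have hsub : ∀ k, u ≤ k → k ≤ v → k ∉ E' := fun k hk1 hk2 =>
    h4 ⟨h5.trans_le hk1, hk2.trans_lt h8⟩
  obtain ⟨x, hx⟩ := hR2 u hu
  obtain ⟨y, hy⟩ := hR2 v hv
  have hs : GNSim E x y := by
    refine hsim _ hx _ hy ?_
    intro k hk hkf
    rw [Set.uIcc_of_le huv.le] at hk
    exact hsub k hk.1 hk.2 (hE'.frontier_subset hkf)
  have hxE : x ∉ E := hcol _ hx (hsub u le_rfl huv.le)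
  have hxt : x < t := (hf _ hx).1.2 h6
  have hty : t < y := (hf _ hy).2.2 h7
  refine gn_not_sim (e := t) (y := x) ?_ Set.left_mem_uIcc ht hxE hs
  rw [Set.uIcc_of_le (hxt.trans hty).le]
  exact ⟨hxt.le, hty.le⟩

theorem gn_homeo {E E' : Set ℝ} (hE : GNGood E) (hE' : GNGood E') (hne : E.Nonempty)
    (hne' : E'.Nonempty) (hint : (interior E).Nonempty ↔ (interior E').Nonempty) :
    Nonempty (E ≃ₜ E') := by
  obtain ⟨A, B, hAB, hEAB⟩ := gn_bounds hE
  obtain ⟨A', B', hAB', hEAB'⟩ := gn_bounds hE'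
  have hcl := hE.cpt.isClosed
  have hcl' := hE'.cpt.isClosed
  have hAE : A ∉ E := fun h => (hEAB h).1.false
  have hBE : B ∉ E := fun h => (hEAB h).2.false
  have hAE' : A' ∉ E' := fun h => (hEAB' h).1.false
  have hBE' : B' ∉ E' := fun h => (hEAB' h).2.false
  have hA : A ∈ GNQ E A B := ⟨⟨le_rfl, hAB.le⟩, fun h => hAE (hcl.frontier_subset h), Or.inl rfl⟩
  have hB : B ∈ GNQ E A B :=
    ⟨⟨hAB.le, le_rfl⟩, fun h => hBE (hcl.frontier_subset h), Or.inr (Or.inl rfl)⟩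
  have hA' : A' ∈ GNQ E' A' B' :=
    ⟨⟨le_rfl, hAB'.le⟩, fun h => hAE' (hcl'.frontier_subset h), Or.inl rfl⟩
  have hB' : B' ∈ GNQ E' A' B' :=
    ⟨⟨hAB'.le, le_rfl⟩, fun h => hBE' (hcl'.frontier_subset h), Or.inr (Or.inl rfl)⟩
  have hc := gn_colOrd hE hA hB
  have hc' := gn_colOrd hE' hA' hB'
  rw [← hint] at hc'
  have : Countable (GNQ E A B) := (gn_Q_countable E A B).to_subtype
  have : Countable (GNQ E' A' B') := (gn_Q_countable E' A' B').to_subtype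
  have hnAB : ¬ GNSim E A B := by
    obtain ⟨e, he⟩ := hne
    refine gn_not_sim (e := e) (y := A) ?_ Set.left_mem_uIcc he hAE
    rw [Set.uIcc_of_le hAB.le]; exact ⟨(hEAB he).1.le, (hEAB he).2.le⟩
  have hnAB' : ¬ GNSim E' A' B' := by
    obtain ⟨e, he⟩ := hne'
    refine gn_not_sim (e := e) (y := A') ?_ Set.left_mem_uIcc he hAE'
    rw [Set.uIcc_of_le hAB'.le]; exact ⟨(hEAB' he).1.le, (hEAB' he).2.le⟩
  have hnBA : ¬ GNSim E B A := fun h => hnAB fun k hk => h k (by rwa [Set.uIcc_comm])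
  have hnBA' : ¬ GNSim E' B' A' := fun h => hnAB' fun k hk => h k (by rwa [Set.uIcc_comm])
  obtain ⟨R, hR1, hR2, hRel, hRd, hRc⟩ := gn_iso hc hc' (by
    intro p hp q hq
    simp only [Set.mem_insert_iff, Set.mem_singleton_iff] at hp hq
    rcases hp with rfl | rfl <;> rcases hq with rfl | rfl
    · exact ⟨by simp, iff_of_true (hc.refl _) (hc'.refl _), iff_of_false hAE hAE'⟩
    · exact ⟨iff_of_true hAB hAB', iff_of_false hnAB hnAB', iff_of_false hAE hAE'⟩
    · exact ⟨iff_of_false hAB.not_gt hAB'.not_gt, iff_of_false hnBA hnBA', iff_of_false hBE hBE'⟩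
    · exact ⟨by simp, iff_of_true (hc.refl _) (hc'.refl _), iff_of_false hBE hBE'⟩)
  let R' : Set (ℝ × ℝ) := (fun p => ((p.1 : ℝ), (p.2 : ℝ))) '' R
  have hAR : (A, A') ∈ R' := ⟨_, hR1, rfl⟩
  have hBR : (B, B') ∈ R' := ⟨_, hR2, rfl⟩
  have hRel' : ∀ p ∈ R', ∀ q ∈ R', (p.1 < q.1 ↔ p.2 < q.2) ∧
      (GNSim E p.1 q.1 ↔ GNSim E' p.2 q.2) ∧ (p.1 ∈ E ↔ p.2 ∈ E') := by
    rintro _ ⟨p, hp, rfl⟩ _ ⟨q, hq, rfl⟩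
    exact hRel p hp q hq
  have hRd' : ∀ x ∈ GNQ E A B, ∃ y, (x, y) ∈ R' := by
    intro x hx
    obtain ⟨b, hb⟩ := hRd ⟨x, hx⟩
    exact ⟨b, _, hb, rfl⟩
  have hRc' : ∀ y ∈ GNQ E' A' B', ∃ x, (x, y) ∈ R' := by
    intro y hy
    obtain ⟨b, hb⟩ := hRc ⟨y, hy⟩
    exact ⟨b, _, hb, rfl⟩
  obtain ⟨h, hh⟩ := gn_extend R' A B A' B' hAR hBR
    (by rintro _ ⟨p, hp, rfl⟩; exact p.1.2.1)
    (by rintro _ ⟨p, hp, rfl⟩; exact p.2.2.1)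
    (fun p hp q hq => (hRel' p hp q hq).1)
    (by
      intro s t h1 h2 h3
      obtain ⟨x, hx, h4⟩ := gn_Q_dense hcl h1 h2 h3
      obtain ⟨y, hy⟩ := hRd' x hx
      exact ⟨_, hy, h4⟩)
    (by
      intro s t h1 h2 h3
      obtain ⟨x, hx, h4⟩ := gn_Q_dense hcl' h1 h2 h3
      obtain ⟨y, hy⟩ := hRc' x hx
      exact ⟨_, hy, h4⟩)
  have hI : ∀ t ∈ E, t ∈ Set.Icc A B := fun t ht => Set.Ioo_subset_Icc_self (hEAB ht)
  have hI' : ∀ t ∈ E', t ∈ Set.Icc A' B' := fun t ht => Set.Ioo_subset_Icc_self (hEAB' ht)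
  have F : ∀ t (ht : t ∈ E), (h ⟨t, hI t ht⟩ : ℝ) ∈ E' := by
    intro t ht
    exact gn_notE_preserve hcl' R' (fun _ => (h ⟨t, hI t ht⟩ : ℝ)) hRc' hAR hBR
      (fun p hp q hq => (hRel' p hp q hq).2.1.2) (fun p hp hn => mt (hRel' p hp p hp).2.2.1 hn)
      hEAB (t := t) (fun p hp => hh ⟨t, hI t ht⟩ p hp) ht
  have G : ∀ t (ht : t ∈ E'), (h.symm ⟨t, hI' t ht⟩ : ℝ) ∈ E := by
    intro t ht
    refine gn_notE_preserve hcl (Prod.swap '' R') (fun _ => (h.symm ⟨t, hI' t ht⟩ : ℝ)) ?_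
      ⟨_, hAR, rfl⟩ ⟨_, hBR, rfl⟩ ?_ ?_ hEAB' (t := t) ?_ ht
    · intro y hy
      obtain ⟨x, hx⟩ := hRd' y hy
      exact ⟨x, _, hx, rfl⟩
    · rintro _ ⟨p, hp, rfl⟩ _ ⟨q, hq, rfl⟩
      exact (hRel' p hp q hq).2.1.1
    · rintro _ ⟨p, hp, rfl⟩ hn
      exact mt (hRel' p hp p hp).2.2.2 hn
    · rintro _ ⟨p, hp, rfl⟩
      have := hh (h.symm ⟨t, hI' t ht⟩) p hp
      rw [Homeomorph.apply_symm_apply] at this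
      exact ⟨this.1.symm, this.2.symm⟩
  exact ⟨
    { toFun := fun t => ⟨h ⟨t, hI t t.2⟩, F t t.2⟩
      invFun := fun t => ⟨h.symm ⟨t, hI' t t.2⟩, G t t.2⟩
      left_inv := fun t => by simp
      right_inv := fun t => by simp
      continuous_toFun := by fun_prop
      continuous_invFun := by fun_prop }⟩


/-- Subsum over a set of indices. -/
noncomputable def gnSub (x : ℕ → ℝ) (M : Set ℕ) : ℝ := ∑' n, M.indicator x n

/-- Subsums of subsets of `S`. -/
def gnAch (x : ℕ → ℝ) (S : Set ℕ) : Set ℝ := {s | ∃ M ⊆ S, s = gnSub x M}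

/-- Indices of small terms. -/
def gnSmall (x : ℕ → ℝ) (t : ℝ) : Set ℕ := {k | x k < t}

theorem gn_ach_univ (x : ℕ → ℝ) : achievementSet x = gnAch x Set.univ := by
  classical
  ext s
  constructor
  · rintro ⟨ε, hε, rfl⟩
    refine ⟨{n | ε n = 1}, Set.subset_univ _, ?_⟩
    unfold gnSub
    congr 1
    ext n
    rcases hε n with h | h <;> simp [Set.indicator, h]
  · rintro ⟨M, -, rfl⟩
    refine ⟨M.indicator 1, fun n => ?_, ?_⟩
    · by_cases h : n ∈ M <;> simp [h]
    · unfold gnSub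
      congr 1
      ext n
      by_cases h : n ∈ M <;> simp [h]

section
variable {x : ℕ → ℝ} (hpos : ∀ n, 0 < x n) (hsum : Summable x)

include hpos hsum in
theorem gnSub_mono {M N : Set ℕ} (h : M ⊆ N) : gnSub x M ≤ gnSub x N :=
  (hsum.indicator M).tsum_le_tsum
    (Set.indicator_le_indicator_of_subset h (fun n => (hpos n).le)) (hsum.indicator N)

theorem gnSub_empty : gnSub x ∅ = 0 := by simp [gnSub]

include hpos in
theorem gnSub_nonneg (M : Set ℕ) : 0 ≤ gnSub x M :=
  tsum_nonneg fun n => Set.indicator_nonneg (fun n _ => (hpos n).le) n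

theorem gnSub_single (k : ℕ) : gnSub x {k} = x k := by
  unfold gnSub
  rw [tsum_eq_single k]
  · simp
  · intro n hn; simp [hn]

include hsum in
theorem gnSub_union {M N : Set ℕ} (h : Disjoint M N) :
    gnSub x (M ∪ N) = gnSub x M + gnSub x N := by
  unfold gnSub
  rw [Set.indicator_union_of_disjoint h]
  exact (hsum.indicator M).tsum_add (hsum.indicator N)

include hsum in
theorem gnSub_split (M S : Set ℕ) : gnSub x M = gnSub x (M ∩ S) + gnSub x (M ∩ Sᶜ) := by
  rw [← gnSub_union hsum, Set.inter_union_compl]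
  exact Set.disjoint_of_subset Set.inter_subset_right Set.inter_subset_right disjoint_compl_right

include hpos hsum in
theorem gnSub_le_of_mem {M : Set ℕ} {k : ℕ} (hk : k ∈ M) : x k ≤ gnSub x M := by
  rw [← gnSub_single (x := x) k]
  exact gnSub_mono hpos hsum (by simpa using hk)

include hpos hsum in
theorem gnAch_compact (S : Set ℕ) : IsCompact (gnAch x S) := by
  classical
  have h : gnAch x S = Set.range (fun b : ℕ → Bool =>
      ∑' n, (if b n = true ∧ n ∈ S then x n else 0)) := by
    ext s
    constructor
    · rintro ⟨M, hM, rfl⟩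
      refine ⟨fun n => decide (n ∈ M), ?_⟩
      unfold gnSub
      simp only
      congr 1
      ext n
      by_cases h : n ∈ M
      · simp [h, hM h]
      · simp [h]
    · rintro ⟨b, rfl⟩
      refine ⟨{n | b n = true ∧ n ∈ S}, fun n hn => hn.2, ?_⟩
      unfold gnSub
      simp only
      congr 1
      ext n
      simp [Set.indicator]
  rw [h]
  refine isCompact_range ?_
  refine continuous_tsum (u := x) ?_ hsum ?_
  · intro n
    by_cases hn : n ∈ S
    · simp only [hn, and_true]
      have : Continuous (fun c : Bool => if c = true then x n else 0) := continuous_of_discreteTopology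
      exact this.comp (continuous_apply n)
    · simp only [hn, and_false, if_false]
      exact continuous_const
  · intro n b
    split_ifs
    · simp [abs_of_pos (hpos n)]
    · simp [(hpos n).le]

include hsum in
theorem gn_big_finite {t : ℝ} (ht : 0 < t) : ((gnSmall x t)ᶜ).Finite := by
  have h := hsum.tendsto_cofinite_zero.eventually (gt_mem_nhds ht)
  exact h

include hpos hsum in
theorem gn_small_sum {e : ℝ} (he : 0 < e) : ∃ t > 0, gnSub x (gnSmall x t) < e := by
  obtain ⟨s, hs⟩ := summable_iff_vanishing_norm.1 hsum (e / 2) (by linarith)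
  obtain ⟨t, ht, hts⟩ : ∃ t > 0, ∀ k ∈ s, t ≤ x k := by
    rcases s.eq_empty_or_nonempty with rfl | hne
    · exact ⟨1, one_pos, by simp⟩
    · obtain ⟨k, -, hk⟩ := s.exists_min_image x hne
      exact ⟨x k, hpos k, hk⟩
  refine ⟨t, ht, ?_⟩
  have : gnSub x (gnSmall x t) ≤ e / 2 := by
    unfold gnSub
    refine (hsum.indicator _).tsum_le_of_sum_le ?_
    intro u
    classical
    have h1 : ∑ i ∈ u, (gnSmall x t).indicator x i = ∑ i ∈ u.filter (fun i => i ∈ gnSmall x t), x i := by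
      rw [Finset.sum_filter]
      rfl
    rw [h1]
    have h2 := hs (u.filter (fun i => i ∈ gnSmall x t)) (by
      rw [Finset.disjoint_left]
      intro k hk hks
      have h3 : x k < t := (Finset.mem_filter.1 hk).2
      exact absurd (hts k hks) (not_le.2 h3))
    exact (le_abs_self _).trans h2.le
  linarith

theorem gnSmall_mono {s t : ℝ} (h : s ≤ t) : gnSmall x s ⊆ gnSmall x t := fun _ hk => lt_of_lt_of_le hk h

include hsum in
theorem gn_exists_small {e : ℝ} (he : 0 < e) : ∃ k, x k < e :=
  ((hsum.tendsto_atTop_zero).eventually (gt_mem_nhds he)).exists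

/-- finite sums -/
theorem gn_fin_finite {S : Set ℕ} (hS : S.Finite) : (gnAch x S).Finite := by
  have : gnAch x S = gnSub x '' {M | M ⊆ S} := by
    ext s
    simp [gnAch, eq_comm]
  rw [this]
  exact hS.finite_subsets.image _

include hsum in
theorem gn_decomp (S : Set ℕ) : gnAch x Set.univ = ⋃ f ∈ gnAch x Sᶜ, (fun y => y + f) '' gnAch x S := by
  ext s
  simp only [Set.mem_iUnion, Set.mem_image]
  constructor
  · rintro ⟨M, -, rfl⟩
    exact ⟨gnSub x (M ∩ Sᶜ), ⟨_, Set.inter_subset_right, rfl⟩, gnSub x (M ∩ S),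
      ⟨_, Set.inter_subset_right, rfl⟩, (gnSub_split hsum M S).symm⟩
  · rintro ⟨_, ⟨M, hM, rfl⟩, _, ⟨N, hN, rfl⟩, rfl⟩
    exact ⟨N ∪ M, Set.subset_univ _, (gnSub_union hsum
      (Set.disjoint_of_subset hN hM disjoint_compl_right)).symm⟩

theorem gn_interior_biUnion {ι : Type*} {F : Set ι} (hF : F.Finite) (f : ι → Set ℝ)
    (hc : ∀ i ∈ F, IsClosed (f i)) (hi : ∀ i ∈ F, interior (f i) = ∅) :
    interior (⋃ i ∈ F, f i) = ∅ := by
  induction F, hF using Set.Finite.induction_on with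
  | empty => simp
  | @insert a s ha hs ih =>
    rw [Set.biUnion_insert, Set.union_comm]
    have h1 : IsClosed (⋃ i ∈ s, f i) := hs.isClosed_biUnion fun i hi => hc i (Or.inr hi)
    rw [interior_union_isClosed_of_interior_empty h1 (hi a (Or.inl rfl))]
    exact ih (fun i h => hc i (Or.inr h)) (fun i h => hi i (Or.inr h))

include hpos hsum in
theorem gn_small_interior (hi : (interior (gnAch x Set.univ)).Nonempty) {t : ℝ} (ht : 0 < t) :
    (interior (gnAch x (gnSmall x t))).Nonempty := by
  by_contra hcon
  rw [Set.not_nonempty_iff_eq_empty] at hcon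
  rw [gn_decomp hsum (gnSmall x t), gn_interior_biUnion (gn_fin_finite (gn_big_finite hsum ht))] at hi
  · exact Set.not_nonempty_empty hi
  · intro f _
    exact ((gnAch_compact hpos hsum _).image (by fun_prop)).isClosed
  · intro f _
    have := (Homeomorph.addRight f).image_interior (gnAch x (gnSmall x t))
    rw [hcon, Set.image_empty] at this
    exact this.symm

/-- infinitely many gap indices -/
def GNGaps (x : ℕ → ℝ) : Prop := ∀ t > 0, ∃ k, x k < t ∧ gnSub x (gnSmall x (x k)) < x k

include hpos hsum in
theorem gn_ach_right (h : ¬ (interior (gnAch x Set.univ)).Nonempty ∨ GNGaps x) :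
    GNRight (gnAch x Set.univ) := by
  rintro p q hpq ⟨M, -, hM⟩ hgap d hqd
  obtain ⟨t, ht, htr⟩ := gn_small_sum hpos hsum (sub_pos.2 hpq)
  have hmem : ∀ N, gnSub x N ∈ gnAch x Set.univ := fun N => ⟨N, Set.subset_univ _, rfl⟩
  set M1 := M ∩ (gnSmall x t)ᶜ with hM1
  have hq : q = gnSub x M1 := by
    have h1 := gnSub_split hsum M (gnSmall x t)
    have h2 : gnSub x (M ∩ gnSmall x t) ≤ gnSub x (gnSmall x t) :=
      gnSub_mono hpos hsum Set.inter_subset_right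
    have h3 := gnSub_nonneg hpos (M ∩ gnSmall x t)
    rw [← hM1] at h1
    by_contra hne
    refine hgap (gnSub x M1) (by linarith) ?_ (hmem _)
    exact lt_of_le_of_ne (by linarith) (fun h => hne h.symm)
  have hadd : ∀ N ⊆ gnSmall x t, q + gnSub x N = gnSub x (M1 ∪ N) := by
    intro N hN
    rw [hq, gnSub_union hsum]
    exact Set.disjoint_of_subset Set.inter_subset_right hN disjoint_compl_left
  have hE : ∃ y, q < y ∧ y < d ∧ y ∈ gnAch x Set.univ := by
    obtain ⟨k, hk⟩ := gn_exists_small hsum (lt_min ht (sub_pos.2 hqd))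
    have hk := lt_min_iff.1 hk
    refine ⟨q + x k, by linarith [hpos k], by linarith, ?_⟩
    have := hadd {k} (Set.singleton_subset_iff.2 hk.1)
    rw [gnSub_single] at this
    rw [this]
    exact hmem _
  refine ⟨?_, hE, ?_⟩
  · rcases h with h | h
    · obtain ⟨e, he1, he2, he⟩ := hE
      by_contra hcon
      push Not at hcon
      apply h
      obtain ⟨y, hy⟩ := exists_between he1
      exact ⟨y, mem_interior.2 ⟨Set.Ioo q e, fun z hz => hcon z hz.1 (hz.2.trans he2), isOpen_Ioo, hy⟩⟩
    · have hF := gn_fin_finite (x := x) (gn_big_finite hsum ht)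
      have hFc : IsClosed (gnAch x (gnSmall x t)ᶜ \ {q}) := (hF.subset Set.sdiff_subset).isClosed
      obtain ⟨l, r, h1, h2⟩ := mem_nhds_iff_exists_Ioo_subset.1
        (hFc.isOpen_compl.mem_nhds (show q ∈ _ from fun h => h.2 rfl))
      obtain ⟨k, hk, hkr⟩ := h (min t (min (r - q) (d - q)))
        (lt_min ht (lt_min (sub_pos.2 h1.2) (sub_pos.2 hqd)))
      obtain ⟨hk1, hk2⟩ := lt_min_iff.1 hk
      obtain ⟨hk2, hk3⟩ := lt_min_iff.1 hk2
      obtain ⟨m, hm1, hm2⟩ := exists_between hkr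
      have hm0 : 0 < m := (gnSub_nonneg hpos _).trans_lt hm1
      refine ⟨q + m, by linarith, by linarith, ?_⟩
      rintro ⟨N, -, hN⟩
      rw [gnSub_split hsum N (gnSmall x t)] at hN
      have hNs : gnSub x (N ∩ gnSmall x t) ≤ gnSub x (gnSmall x t) :=
        gnSub_mono hpos hsum Set.inter_subset_right
      have hN0 := gnSub_nonneg hpos (N ∩ gnSmall x t)
      rcases lt_trichotomy (gnSub x (N ∩ (gnSmall x t)ᶜ)) q with hlt | heq | hgt
      · have : gnSub x (N ∩ (gnSmall x t)ᶜ) ≤ p := by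
          by_contra hcon
          exact hgap _ (not_le.1 hcon) hlt (hmem _)
        linarith
      · have hm : gnSub x (N ∩ gnSmall x t) = m := by linarith
        have hsub : N ∩ gnSmall x t ⊆ gnSmall x (x k) := by
          intro j hj
          have := gnSub_le_of_mem hpos hsum hj
          change x j < x k
          linarith
        have := gnSub_mono hpos hsum hsub
        linarith
      · have := h2 (show gnSub x (N ∩ (gnSmall x t)ᶜ) ∈ Set.Ioo l r from
          ⟨h1.1.trans hgt, by linarith⟩)
        exact this ⟨⟨_, Set.inter_subset_right, rfl⟩, hgt.ne'⟩
  · intro hi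
    obtain ⟨s, hs, hsr⟩ := gn_small_sum hpos hsum (sub_pos.2 hqd)
    obtain ⟨z, hz⟩ := gn_small_interior hpos hsum hi (lt_min hs ht)
    have hsub : gnAch x (gnSmall x (min s t)) ⊆ Set.Icc 0 (gnSub x (gnSmall x s)) := by
      rintro _ ⟨N, hN, rfl⟩
      exact ⟨gnSub_nonneg hpos N,
        gnSub_mono hpos hsum (hN.trans (gnSmall_mono (min_le_left _ _)))⟩
    have hz2 := interior_mono hsub hz
    rw [interior_Icc] at hz2
    refine ⟨q + z, by linarith [hz2.1], by linarith [hz2.2], ?_⟩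
    refine mem_interior.2 ⟨(Homeomorph.addLeft q) '' interior (gnAch x (gnSmall x (min s t))), ?_,
      (Homeomorph.addLeft q).isOpenMap _ isOpen_interior, ⟨z, hz, rfl⟩⟩
    rintro _ ⟨w, hw, rfl⟩
    obtain ⟨N, hN, rfl⟩ := interior_subset hw
    change q + gnSub x N ∈ _
    rw [hadd N (hN.trans (gnSmall_mono (min_le_right _ _)))]
    exact hmem _

theorem gn_right_translate {E : Set ℝ} (hE : GNRight E) (c : ℝ) :
    GNRight ((Homeomorph.addRight c) ⁻¹' E) := by
  intro p q hpq hq hgap d hqd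
  have hh : ∀ y, y ∈ (Homeomorph.addRight c) ⁻¹' E ↔ y + c ∈ E := fun y => Iff.rfl
  rw [← Homeomorph.preimage_interior]
  have := hE (p + c) (q + c) (by linarith) hq (by
    intro y h1 h2 h3
    refine hgap (y - c) (by linarith) (by linarith) ?_
    rw [hh, sub_add_cancel]
    exact h3) (d + c) (by linarith)
  obtain ⟨⟨y, h1, h2, h3⟩, ⟨z, h4, h5, h6⟩, h7⟩ := this
  refine ⟨⟨y - c, by linarith, by linarith, ?_⟩, ⟨z - c, by linarith, by linarith, ?_⟩, ?_⟩
  · rw [hh, sub_add_cancel]; exact h3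
  · rw [hh, sub_add_cancel]; exact h6
  · rintro ⟨w, hw⟩
    obtain ⟨y, h1, h2, h3⟩ := h7 ⟨_, hw⟩
    refine ⟨y - c, by linarith, by linarith, ?_⟩
    change y - c + c ∈ interior E
    rw [sub_add_cancel]; exact h3

include hpos hsum in
theorem gn_ach_good (h : ¬ (interior (gnAch x Set.univ)).Nonempty ∨ GNGaps x) :
    GNGood (gnAch x Set.univ) := by
  refine ⟨gnAch_compact hpos hsum _, gn_ach_right hpos hsum h, ?_⟩
  have : - gnAch x Set.univ = (Homeomorph.addRight (gnSub x Set.univ)) ⁻¹' (gnAch x Set.univ) := by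
    have hc : ∀ M, gnSub x Set.univ = gnSub x M + gnSub x Mᶜ := by
      intro M
      have := gnSub_split hsum Set.univ M
      simpa using this
    ext y
    simp only [Set.mem_neg, Set.mem_preimage, Homeomorph.coe_addRight]
    constructor
    · rintro ⟨M, -, hM⟩
      exact ⟨Mᶜ, Set.subset_univ _, by linarith [hc M]⟩
    · rintro ⟨M, -, hM⟩
      exact ⟨Mᶜ, Set.subset_univ _, by linarith [hc M]⟩
  rw [this]
  exact gn_right_translate (gn_ach_right hpos hsum h) _

include hpos hsum in
theorem gn_interval {t : ℝ} (ht : 0 < t) (h : ∀ k, x k < t → x k ≤ gnSub x (gnSmall x (x k))) :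
    gnAch x (gnSmall x t) = Set.Icc 0 (gnSub x (gnSmall x t)) := by
  classical
  apply Set.Subset.antisymm
  · rintro _ ⟨N, hN, rfl⟩
    exact ⟨gnSub_nonneg hpos N, gnSub_mono hpos hsum hN⟩
  intro y hy
  rw [← (gnAch_compact hpos hsum (gnSmall x t)).isClosed.closure_eq, Metric.mem_closure_iff]
  intro e he
  obtain ⟨δ, hδ, hδr⟩ := gn_small_sum hpos hsum he
  have key : ∀ s : Finset ℕ, (∀ k ∈ s, δ ≤ x k ∧ x k < t) →
      (∀ k ∈ s, ∀ j, x j < x k → δ ≤ x j → j ∈ s) →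
      ∀ y, 0 ≤ y → y ≤ gnSub x s + gnSub x (gnSmall x δ) →
      ∃ N : Set ℕ, N ⊆ s ∧ gnSub x N ≤ y ∧ y ≤ gnSub x N + gnSub x (gnSmall x δ) := by
    intro s
    induction s using Finset.induction_on_max_value x with
    | empty =>
      intro _ _ y hy0 hy1
      exact ⟨∅, by simp, by simpa [gnSub_empty] using hy0, by simpa using hy1⟩
    | insert a s has hmax ih =>
      intro hs hdown y hy0 hy1
      have ih := ih (fun k hk => hs k (Finset.mem_insert_of_mem hk)) (by
        intro k hk j hj hjδ
        rcases Finset.mem_insert.1 (hdown k (Finset.mem_insert_of_mem hk) j hj hjδ) with rfl | h'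
        · exact absurd (hmax k hk) (not_le.2 hj)
        · exact h')
      have hins : gnSub x ↑(insert a s) = x a + gnSub x s := by
        rw [Finset.coe_insert, Set.insert_eq, gnSub_union hsum (by simpa using has), gnSub_single]
      have hins' : ∀ N : Set ℕ, N ⊆ s → gnSub x (insert a N) = x a + gnSub x N := by
        intro N hN
        rw [Set.insert_eq, gnSub_union hsum (by
          simp only [Set.disjoint_singleton_left]
          exact fun h' => has (hN h')), gnSub_single]
      by_cases hle : y ≤ gnSub x s + gnSub x (gnSmall x δ)
      · obtain ⟨N, hN, h1⟩ := ih y hy0 hle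
        exact ⟨N, hN.trans (by simp), h1⟩
      · have ha := hs a (Finset.mem_insert_self _ _)
        have h1 := h a ha.2
        have h2 : gnSub x (gnSmall x (x a)) ≤ gnSub x (↑s ∪ gnSmall x δ) := by
          refine gnSub_mono hpos hsum ?_
          intro j hj
          by_cases hjδ : x j < δ
          · exact Or.inr hjδ
          · left
            rcases Finset.mem_insert.1 (hdown a (Finset.mem_insert_self _ _) j hj (not_lt.1 hjδ))
              with rfl | h'
            · exact absurd hj (lt_irrefl (x j))
            · exact h'
        rw [gnSub_union hsum (by
          rw [Set.disjoint_left]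
          intro k hk hk'
          exact absurd (hs k (Finset.mem_insert_of_mem hk)).1 (not_le.2 hk'))] at h2
        obtain ⟨N, hN, h3, h4⟩ := ih (y - x a) (by linarith) (by linarith)
        refine ⟨insert a N, ?_, ?_, ?_⟩
        · rw [Finset.coe_insert]
          exact Set.insert_subset_insert hN
        · rw [hins' N hN]; linarith
        · rw [hins' N hN]; linarith
  have hfin : {k | δ ≤ x k ∧ x k < t}.Finite :=
    (gn_big_finite hsum hδ).subset (fun k hk => not_lt.2 hk.1)
  have hsub : gnSub x (gnSmall x t) ≤ gnSub x ↑hfin.toFinset + gnSub x (gnSmall x δ) := by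
    rw [← gnSub_union hsum]
    · refine gnSub_mono hpos hsum ?_
      intro k hk
      by_cases hkδ : x k < δ
      · exact Or.inr hkδ
      · left
        simp only [Set.Finite.coe_toFinset]
        exact ⟨not_lt.1 hkδ, hk⟩
    · rw [Set.disjoint_left]
      intro k hk hk'
      simp only [Set.Finite.coe_toFinset] at hk
      exact absurd hk.1 (not_le.2 hk')
  obtain ⟨N, hN, h1, h2⟩ := key hfin.toFinset (by simp) (by
    simp only [Set.Finite.mem_toFinset]
    rintro k hk j hj hjδ
    exact ⟨hjδ, hj.trans hk.2⟩) y hy.1 (hy.2.trans hsub)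
  refine ⟨gnSub x N, ⟨N, ?_, rfl⟩, ?_⟩
  · intro k hk
    have := hN hk
    simp only [Set.Finite.coe_toFinset] at this
    exact this.2
  · rw [Real.dist_eq, abs_lt]
    constructor <;> linarith

include hpos hsum in
theorem gn_finite_union (h : ¬ GNGaps x) : IsFiniteUnionOfClosedIntervals (gnAch x Set.univ) := by
  classical
  unfold GNGaps at h
  push Not at h
  obtain ⟨t, ht, h⟩ := h
  have hF := gn_fin_finite (x := x) (gn_big_finite hsum ht)
  refine ⟨hF.toFinset.image (fun f => (f, gnSub x (gnSmall x t) + f)), ?_⟩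
  rw [gn_decomp hsum (gnSmall x t), gn_interval hpos hsum ht h]
  ext y
  simp

end

open Filter Topology

/-- The Guthrie–Nymann sequence. -/
noncomputable def gnSeq (n : ℕ) : ℝ := (if n % 2 = 0 then 3 else 2) / 4 ^ (n / 2 + 1)

theorem gnSeq_even (i : ℕ) : gnSeq (2 * i) = 3 / 4 ^ (i + 1) := by
  simp [gnSeq]

theorem gnSeq_odd (i : ℕ) : gnSeq (2 * i + 1) = 2 / 4 ^ (i + 1) := by
  have h1 : (2 * i + 1) % 2 = 1 := by omega
  have h2 : (2 * i + 1) / 2 = i := by omega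
  simp [gnSeq, h1, h2]

theorem gnSeq_pos (n : ℕ) : 0 < gnSeq n := by
  unfold gnSeq
  split_ifs <;> positivity

theorem gn_geom (c : ℝ) : HasSum (fun i : ℕ => c / 4 ^ (i + 1)) (c / 3) := by
  have h := (hasSum_geometric_of_lt_one (r := (1 / 4 : ℝ)) (by norm_num) (by norm_num)).mul_left (c / 4)
  have e1 : (fun i : ℕ => c / 4 ^ (i + 1)) = fun i : ℕ => c / 4 * (1 / 4) ^ i := by
    funext i
    rw [one_div, inv_pow, pow_succ]
    field_simp
  have e2 : c / 3 = c / 4 * (1 - 1 / 4)⁻¹ := by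
    norm_num
    ring
  rw [e1, e2]
  exact h

theorem gnSeq_hasSum : HasSum gnSeq (5 / 3) := by
  have h1 : HasSum (fun i => gnSeq (2 * i)) (3 / 3) := by
    simp only [gnSeq_even]; exact gn_geom 3
  have h2 : HasSum (fun i => gnSeq (2 * i + 1)) (2 / 3) := by
    simp only [gnSeq_odd]; exact gn_geom 2
  have := h1.even_add_odd h2
  convert this using 1
  norm_num

theorem gn_set_eq : guthrieNymannSet = gnAch gnSeq Set.univ := by
  rw [← gn_ach_univ]
  have key : ∀ ε : ℕ → ℝ, (∀ n, ε n = 0 ∨ ε n = 1) →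
      ∑' i : ℕ, (ε (2 * i) * (3 / 4 ^ (i + 1)) + ε (2 * i + 1) * (2 / 4 ^ (i + 1))) =
      ∑' n, ε n * gnSeq n := by
    intro ε hε
    have hb : Summable (fun n => ε n * gnSeq n) := by
      refine Summable.of_nonneg_of_le ?_ ?_ gnSeq_hasSum.summable
      · intro n
        rcases hε n with h | h <;> simp [h, (gnSeq_pos n).le]
      · intro n
        rcases hε n with h | h <;> simp [h, (gnSeq_pos n).le]
    have h1 : Summable (fun i => ε (2 * i) * gnSeq (2 * i)) :=
      hb.comp_injective (i := fun i => 2 * i) (fun a b h => by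
        have h : 2 * a = 2 * b := h
        omega)
    have h2 : Summable (fun i => ε (2 * i + 1) * gnSeq (2 * i + 1)) :=
      hb.comp_injective (i := fun i => 2 * i + 1) (fun a b h => by
        have h : 2 * a + 1 = 2 * b + 1 := h
        omega)
    have h3 := tsum_even_add_odd (f := fun n => ε n * gnSeq n) h1 h2
    have h4 := h1.tsum_add h2
    rw [← h3]
    refine Eq.trans ?_ h4
    congr 1
    funext i
    rw [gnSeq_even, gnSeq_odd]
  ext s
  constructor
  · rintro ⟨ε, hε, rfl⟩
    exact ⟨ε, hε, key ε hε⟩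
  · rintro ⟨ε, hε, rfl⟩
    exact ⟨ε, hε, (key ε hε).symm⟩

theorem gnSeq_shift (m n : ℕ) : gnSeq (n + 2 * m) = gnSeq n / 4 ^ m := by
  have h1 : (n + 2 * m) % 2 = n % 2 := by omega
  have h2 : (n + 2 * m) / 2 = n / 2 + m := by omega
  unfold gnSeq
  rw [h1, h2, div_div, ← pow_add]
  congr 2
  ring

theorem gn_tail (m : ℕ) : gnSub gnSeq {n | 2 * m ≤ n} = 5 / 3 / 4 ^ m := by
  unfold gnSub
  rw [← ((gnSeq_hasSum.summable.indicator _).sum_add_tsum_nat_add (2 * m))]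
  rw [Finset.sum_eq_zero, zero_add]
  · have : ∀ i, ({n | 2 * m ≤ n} : Set ℕ).indicator gnSeq (i + 2 * m) = gnSeq i / 4 ^ m := by
      intro i
      rw [Set.indicator_of_mem (by simp), gnSeq_shift]
    simp only [this]
    rw [tsum_div_const, gnSeq_hasSum.tsum_eq]
  · intro i hi
    rw [Finset.mem_range] at hi
    exact Set.indicator_of_notMem (by simpa using hi) _

theorem gnSeq_gaps : GNGaps gnSeq := by
  intro t ht
  have h0 : Tendsto (fun i : ℕ => gnSeq (2 * i + 1)) atTop (𝓝 0) := by
    simp only [gnSeq_odd]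
    exact (gn_geom 2).summable.tendsto_atTop_zero
  obtain ⟨i, hi⟩ := (h0.eventually (gt_mem_nhds ht)).exists
  refine ⟨2 * i + 1, hi, ?_⟩
  have hsub : gnSmall gnSeq (gnSeq (2 * i + 1)) ⊆ {n | 2 * (i + 1) ≤ n} := by
    intro n hn
    by_contra hcon
    simp only [Set.mem_ofPred_eq, not_le] at hcon
    have hn : gnSeq n < gnSeq (2 * i + 1) := hn
    rw [gnSeq_odd] at hn
    unfold gnSeq at hn
    have h1 : (2 : ℝ) / 4 ^ (i + 1) ≤ (if n % 2 = 0 then 3 else 2) / 4 ^ (n / 2 + 1) := by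
      refine div_le_div₀ (by split_ifs <;> norm_num) (by split_ifs <;> norm_num) (by positivity) ?_
      exact pow_le_pow_right₀ (by norm_num) (by omega)
    linarith
  have h2 := gnSub_mono gnSeq_pos gnSeq_hasSum.summable hsub
  rw [gn_tail] at h2
  rw [gnSeq_odd (i)]
  rw [gnSeq_odd] at h2
  have h3 : (5 : ℝ) / 3 / 4 ^ (i + 1) < 2 / 4 ^ (i + 1) := by
    apply div_lt_div_of_pos_right (by norm_num) (by positivity)
  linarith

theorem gnSub_insert {x : ℕ → ℝ} (hsum : Summable x) {N : Set ℕ} {a : ℕ} (ha : a ∉ N) :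
    gnSub x (insert a N) = x a + gnSub x N := by
  rw [Set.insert_eq, gnSub_union hsum (by simpa using ha), gnSub_single]

theorem gn_digits (n : ℕ) : ∀ M : ℤ, 2 * (4 ^ n - 1) ≤ 3 * M → M ≤ 4 ^ n - 1 →
    ∃ N : Set ℕ, (∀ k ∈ N, k < 2 * n) ∧ gnSub gnSeq N = M / 4 ^ n := by
  induction n with
  | zero =>
    intro M h1 h2
    have : M = 0 := by
      simp at h1 h2
      omega
    exact ⟨∅, by simp, by simp [gnSub_empty, this]⟩
  | succ n ih =>
    intro M h1 h2
    have hs := gnSeq_hasSum.summable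
    rw [pow_succ] at h1 h2
    obtain ⟨a, ha⟩ : ∃ a : ℤ, (4 : ℤ) ^ n = 3 * a + 1 := by
      clear ih h1 h2
      induction n with
      | zero => exact ⟨0, by simp⟩
      | succ n ih =>
        obtain ⟨a, ha⟩ := ih
        exact ⟨4 * a + 1, by rw [pow_succ, ha]; ring⟩
    rw [ha] at h1 h2 ih
    have hP : (4 : ℝ) ^ n ≠ 0 := by positivity
    have he := gnSeq_even n
    have ho := gnSeq_odd n
    have hr : M % 4 = 0 ∨ M % 4 = 1 ∨ M % 4 = 2 ∨ M % 4 = 3 := by omega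
    rcases hr with hr | hr | hr | hr
    · obtain ⟨L, rfl⟩ : ∃ L, M = 4 * L := ⟨M / 4, by omega⟩
      obtain ⟨N, hN, hN'⟩ := ih L (by omega) (by omega)
      refine ⟨N, fun k hk => by have := hN k hk; omega, ?_⟩
      rw [hN', pow_succ]
      push_cast
      field_simp
    · obtain ⟨L, rfl⟩ : ∃ L, M = 4 * L + 5 := ⟨(M - 5) / 4, by omega⟩
      obtain ⟨N, hN, hN'⟩ := ih L (by omega) (by omega)
      have hn1 : 2 * n + 1 ∉ N := fun h => by have := hN _ h; omega
      have hn2 : 2 * n ∉ insert (2 * n + 1) N := by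
        rintro (h | h)
        · omega
        · have := hN _ h; omega
      refine ⟨insert (2 * n) (insert (2 * n + 1) N), ?_, ?_⟩
      · rintro k (rfl | rfl | hk)
        · omega
        · omega
        · have := hN k hk; omega
      rw [gnSub_insert hs hn2, gnSub_insert hs hn1, hN', he, ho, pow_succ]
      push_cast
      field_simp
      ring
    · obtain ⟨L, rfl⟩ : ∃ L, M = 4 * L + 2 := ⟨(M - 2) / 4, by omega⟩
      obtain ⟨N, hN, hN'⟩ := ih L (by omega) (by omega)
      have hn1 : 2 * n + 1 ∉ N := fun h => by have := hN _ h; omega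
      refine ⟨insert (2 * n + 1) N, ?_, ?_⟩
      · rintro k (rfl | hk)
        · omega
        · have := hN k hk; omega
      rw [gnSub_insert hs hn1, hN', ho, pow_succ]
      push_cast
      field_simp
      ring
    · obtain ⟨L, rfl⟩ : ∃ L, M = 4 * L + 3 := ⟨(M - 3) / 4, by omega⟩
      obtain ⟨N, hN, hN'⟩ := ih L (by omega) (by omega)
      have hn1 : 2 * n ∉ N := fun h => by have := hN _ h; omega
      refine ⟨insert (2 * n) N, ?_, ?_⟩
      · rintro k (rfl | hk)
        · omega
        · have := hN k hk; omega
      rw [gnSub_insert hs hn1, hN', he, pow_succ]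
      push_cast
      field_simp
      ring

theorem gnSeq_interior : (interior (gnAch gnSeq Set.univ)).Nonempty := by
  have hcl := (gnAch_compact gnSeq_pos gnSeq_hasSum.summable Set.univ).isClosed
  have hsub : Set.Ioo (2 / 3 : ℝ) 1 ⊆ gnAch gnSeq Set.univ := by
    rintro y ⟨hy1, hy2⟩
    rw [← hcl.closure_eq, Metric.mem_closure_iff]
    intro e he
    obtain ⟨n, hn⟩ := exists_pow_lt_of_lt_one he (show (1 / 4 : ℝ) < 1 by norm_num)
    have hP : (0 : ℝ) < 4 ^ n := by positivity
    have hn : (1 : ℝ) / 4 ^ n < e := by simpa using hn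
    have hfl := Int.floor_le (y * 4 ^ n)
    have hfl' := Int.lt_floor_add_one (y * 4 ^ n)
    obtain ⟨N, -, hN⟩ := gn_digits n ⌊y * 4 ^ n⌋ (by
        have h1 : (2 : ℝ) * 4 ^ n - 3 < 3 * ⌊y * 4 ^ n⌋ := by nlinarith
        have h2 : (2 : ℤ) * 4 ^ n - 3 < 3 * ⌊y * 4 ^ n⌋ := by exact_mod_cast h1
        omega) (by
        have h1 : (⌊y * 4 ^ n⌋ : ℝ) < 4 ^ n := by nlinarith
        have h2 : ⌊y * 4 ^ n⌋ < (4 : ℤ) ^ n := by exact_mod_cast h1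
        omega)
    refine ⟨_, ⟨N, Set.subset_univ _, rfl⟩, ?_⟩
    rw [hN, Real.dist_eq]
    have h3 : (⌊y * 4 ^ n⌋ : ℝ) / 4 ^ n ≤ y := by
      rw [div_le_iff₀ hP]; exact hfl
    have h4 : y < (⌊y * 4 ^ n⌋ : ℝ) / 4 ^ n + 1 / 4 ^ n := by
      rw [← add_div, lt_div_iff₀ hP]; exact hfl'
    rw [abs_lt]
    constructor <;> linarith
  exact ⟨5 / 6, mem_interior.2 ⟨_, hsub, isOpen_Ioo, by norm_num, by norm_num⟩⟩

theorem gn_cantor_interior : ¬ (interior cantorSet).Nonempty := by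
  rintro ⟨c, hc⟩
  obtain ⟨l, r, h1, h2⟩ := mem_nhds_iff_exists_Ioo_subset.1 (mem_interior_iff_mem_nhds.1 hc)
  have htd : IsTotallyDisconnected cantorSet := by
    rw [← totallyDisconnectedSpace_subtype_iff]
    exact cantorSetHomeomorphNatToBool.symm.totallyDisconnectedSpace
  have h3 := htd _ h2 isPreconnected_Ioo
  obtain ⟨d, hd1, hd2⟩ := exists_between h1.2
  exact hd1.ne (h3 h1 ⟨h1.1.trans hd1, hd2⟩)

theorem gn_cantor_perfect (c : ℝ) (hc : c ∈ cantorSet) {l r : ℝ} (hl : l < c) (hr : c < r) :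
    ∃ e ∈ cantorSet, e ≠ c ∧ l < e ∧ e < r := by
  let φ := cantorSetHomeomorphNatToBool
  let b := φ ⟨c, hc⟩
  have h1 : Tendsto (fun n => Function.update b n (!b n)) atTop (𝓝 b) := by
    rw [tendsto_pi_nhds]
    intro i
    refine tendsto_const_nhds.congr' ?_
    filter_upwards [eventually_gt_atTop i] with n hn
    rw [Function.update_of_ne hn.ne]
  have h2 : Tendsto (fun n => (φ.symm (Function.update b n (!b n)) : ℝ)) atTop (𝓝 c) := by
    have hb : ((φ.symm b : cantorSet) : ℝ) = c := by simp [b]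
    have h := ((continuous_subtype_val.comp φ.symm.continuous).tendsto b).comp h1
    rw [Function.comp_apply, hb] at h
    exact h
  obtain ⟨n, hn⟩ := (h2.eventually (Ioo_mem_nhds hl hr)).exists
  refine ⟨_, (φ.symm (Function.update b n (!b n))).2, ?_, hn.1, hn.2⟩
  intro h
  have h3 : φ.symm (Function.update b n (!b n)) = ⟨c, hc⟩ := Subtype.ext h
  have h4 : Function.update b n (!b n) = b := by
    rw [← φ.apply_symm_apply (Function.update b n (!b n)), h3]
  have h5 := congrFun h4 n
  simp at h5

theorem gn_right_of_perfect {E : Set ℝ} (hi : ¬ (interior E).Nonempty)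
    (hp : ∀ c ∈ E, ∀ l r, l < c → c < r → ∃ e ∈ E, e ≠ c ∧ l < e ∧ e < r) : GNRight E := by
  intro p q hpq hq hgap d hqd
  obtain ⟨e, he, hne, h1, h2⟩ := hp q hq p d hpq hqd
  have hqe : q < e := by
    rcases lt_or_gt_of_ne hne with h | h
    · exact absurd he (hgap e h1 h)
    · exact h
  refine ⟨?_, ⟨e, hqe, h2, he⟩, fun h => absurd h hi⟩
  by_contra hcon
  push Not at hcon
  apply hi
  obtain ⟨y, hy⟩ := exists_between hqe
  exact ⟨y, mem_interior.2 ⟨Set.Ioo q e, fun z hz => hcon z hz.1 (hz.2.trans h2), isOpen_Ioo, hy⟩⟩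

theorem gn_cantor_good : GNGood cantorSet := by
  refine ⟨isCompact_cantorSet, gn_right_of_perfect gn_cantor_interior
    (fun c hc l r hl hr => gn_cantor_perfect c hc hl hr), gn_right_of_perfect ?_ ?_⟩
  · have := (Homeomorph.neg ℝ).preimage_interior cantorSet
    have h2 : interior (-cantorSet) = - interior cantorSet := by simpa using this.symm
    rw [h2]
    simpa using gn_cantor_interior
  · intro c hc l r hl hr
    obtain ⟨e, he, h1, h2, h3⟩ := gn_cantor_perfect (-c) hc (l := -r) (r := -l)
      (by linarith) (by linarith)
    exact ⟨-e, by simpa using he, fun h => h1 (by linarith), by linarith, by linarith⟩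

/-- (Guthrie–Nymann–Saenz classification) The achievement set of a summable sequence of
positive terms is homeomorphic to the Cantor ternary set, a finite union of closed bounded
intervals, or homeomorphic to the Guthrie–Nymann set `T`. -/
theorem achievementSet_trichotomy (x : ℕ → ℝ) (hpos : ∀ n, 0 < x n) (hsum : Summable x) :
    Nonempty (↥(achievementSet x) ≃ₜ ↥cantorSet) ∨
    IsFiniteUnionOfClosedIntervals (achievementSet x) ∨
    Nonempty (↥(achievementSet x) ≃ₜ ↥guthrieNymannSet) := by
  have hne : ∀ y : ℕ → ℝ, (gnAch y Set.univ).Nonempty := fun y => ⟨_, ∅, Set.subset_univ _, rfl⟩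
  rw [gn_ach_univ, gn_set_eq]
  by_cases hi : (interior (gnAch x Set.univ)).Nonempty
  · right
    by_cases hg : GNGaps x
    · right
      exact gn_homeo (gn_ach_good hpos hsum (Or.inr hg))
        (gn_ach_good gnSeq_pos gnSeq_hasSum.summable (Or.inr gnSeq_gaps)) (hne _) (hne _)
        (iff_of_true hi gnSeq_interior)
    · left
      exact gn_finite_union hpos hsum hg
  · left
    exact gn_homeo (gn_ach_good hpos hsum (Or.inl hi)) gn_cantor_good (hne _)
      ⟨0, zero_mem_cantorSet⟩ (iff_of_false hi gn_cantor_interior)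
end

section
/- (Jones) For every real q with 1/5 ≤ Σ_{i≥1} q^i < 2/9 (equivalently 1/6 ≤ q < 2/11), the achievement set of the multigeometric sequence (3/5, 2/5, 2/5, 2/5 ; q) — the sequence whose terms are (3/5)q^j, (2/5)q^j, (2/5)q^j, (2/5)q^j for j = 0, 1, 2, … — is a Cantorval. -/
/-- The achievement set of the multigeometric sequence `(k_1, …, k_m ; q)`, i.e. the set of
subsums of the sequence `k_1, …, k_m, k_1 q, …, k_m q, k_1 q², …`. -/
def multigeomAchievementSet (m : ℕ) (k : Fin m → ℝ) (q : ℝ) : Set ℝ :=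
  {s : ℝ | ∃ ε : ℕ → Fin m → ℝ, (∀ j i, ε j i = 0 ∨ ε j i = 1) ∧
    s = ∑' j : ℕ, ∑ i, ε j i * (k i * q ^ j)}

/-- A Cantorval. -/
def IsCantorval (A : Set ℝ) : Prop :=
  A.Nonempty ∧ IsCompact A ∧ Perfect A ∧ (interior A).Nonempty ∧
    ¬ IsFiniteUnionOfClosedIntervals A

open Filter Topology Set

/-- The digit set. -/
def jD : Set ℝ := {0, 2/5, 3/5, 4/5, 1, 6/5, 7/5, 9/5}

/-- Sums of digit expansions. -/
def jG (q : ℝ) : Set ℝ := {s | ∃ d : ℕ → ℝ, (∀ j, d j ∈ jD) ∧ s = ∑' j, d j * q ^ j}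

lemma jD_mem (x : ℝ) : x ∈ jD ↔ ∃ e : Fin 4 → ℝ, (∀ i, e i = 0 ∨ e i = 1) ∧
    x = ∑ i, e i * (![3 / 5, 2 / 5, 2 / 5, 2 / 5] : Fin 4 → ℝ) i := by
  constructor
  · intro h
    have key : ∀ a b c d : ℝ, (a = 0 ∨ a = 1) → (b = 0 ∨ b = 1) → (c = 0 ∨ c = 1) →
        (d = 0 ∨ d = 1) → x = a * (3/5) + b * (2/5) + c * (2/5) + d * (2/5) →
        ∃ e : Fin 4 → ℝ, (∀ i, e i = 0 ∨ e i = 1) ∧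
          x = ∑ i, e i * (![3 / 5, 2 / 5, 2 / 5, 2 / 5] : Fin 4 → ℝ) i := by
      intro a b c d ha hb hc hd hx
      refine ⟨![a, b, c, d], ?_, ?_⟩
      · intro i
        fin_cases i <;> simpa
      · simp [Fin.sum_univ_four, hx]
    simp only [jD, mem_insert_iff, mem_singleton_iff] at h
    rcases h with h | h | h | h | h | h | h | h
    · exact key 0 0 0 0 (by simp) (by simp) (by simp) (by simp) (by rw [h]; norm_num)
    · exact key 0 1 0 0 (by simp) (by simp) (by simp) (by simp) (by rw [h]; norm_num)
    · exact key 1 0 0 0 (by simp) (by simp) (by simp) (by simp) (by rw [h]; norm_num)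
    · exact key 0 1 1 0 (by simp) (by simp) (by simp) (by simp) (by rw [h]; norm_num)
    · exact key 1 1 0 0 (by simp) (by simp) (by simp) (by simp) (by rw [h]; norm_num)
    · exact key 0 1 1 1 (by simp) (by simp) (by simp) (by simp) (by rw [h]; norm_num)
    · exact key 1 1 1 0 (by simp) (by simp) (by simp) (by simp) (by rw [h]; norm_num)
    · exact key 1 1 1 1 (by simp) (by simp) (by simp) (by simp) (by rw [h]; norm_num)
  · rintro ⟨e, he, rfl⟩
    simp only [jD, mem_insert_iff, mem_singleton_iff, Fin.sum_univ_four]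
    rcases he 0 with h0 | h0 <;> rcases he 1 with h1 | h1 <;> rcases he 2 with h2 | h2 <;>
      rcases he 3 with h3 | h3 <;> simp [h0, h1, h2, h3] <;> norm_num

lemma jE_eq (q : ℝ) : multigeomAchievementSet 4 ![3 / 5, 2 / 5, 2 / 5, 2 / 5] q = jG q := by
  ext s
  constructor
  · rintro ⟨ε, hε, hs⟩
    refine ⟨fun j => ∑ i, ε j i * (![3 / 5, 2 / 5, 2 / 5, 2 / 5] : Fin 4 → ℝ) i,
      fun j => (jD_mem _).2 ⟨ε j, hε j, rfl⟩, ?_⟩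
    rw [hs]
    refine tsum_congr fun j => ?_
    rw [Finset.sum_mul]
    exact Finset.sum_congr rfl fun i _ => by ring
  · rintro ⟨d, hd, hs⟩
    choose e he hx using fun j => (jD_mem _).1 (hd j)
    refine ⟨e, he, ?_⟩
    rw [hs]
    refine tsum_congr fun j => ?_
    rw [hx j, Finset.sum_mul]
    exact Finset.sum_congr rfl fun i _ => by ring

lemma jD_bd {x : ℝ} (h : x ∈ jD) : 0 ≤ x ∧ x ≤ 9/5 ∧ (x = 0 ∨ 2/5 ≤ x) := by
  simp only [jD, mem_insert_iff, mem_singleton_iff] at h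
  rcases h with h | h | h | h | h | h | h | h <;> subst h <;> norm_num

lemma j_summable {q : ℝ} (q0 : 0 < q) (q1 : q < 1) {d : ℕ → ℝ} (hd : ∀ j, d j ∈ jD) : Summable fun j => d j * q ^ j := by
  refine Summable.of_nonneg_of_le (fun j => ?_) (fun j => ?_)
    ((summable_geometric_of_lt_one q0.le q1).mul_left (9/5))
  · exact mul_nonneg (jD_bd (hd j)).1 (by positivity)
  · exact mul_le_mul_of_nonneg_right (jD_bd (hd j)).2.1 (by positivity)

lemma jG_bd {q : ℝ} (q0 : 0 < q) (q1 : q < 1) {s : ℝ} (h : s ∈ jG q) : 0 ≤ s ∧ s ≤ 9/5 * (1 - q)⁻¹ := by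
  obtain ⟨d, hd, rfl⟩ := h
  refine ⟨tsum_nonneg fun j => mul_nonneg (jD_bd (hd j)).1 (by positivity), ?_⟩
  rw [← tsum_geometric_of_lt_one q0.le q1, ← tsum_mul_left]
  exact (j_summable q0 q1 hd).tsum_le_tsum
    (fun j => mul_le_mul_of_nonneg_right (jD_bd (hd j)).2.1 (by positivity))
    ((summable_geometric_of_lt_one q0.le q1).mul_left (9/5))

lemma jG_split {q : ℝ} (q0 : 0 < q) (q1 : q < 1) {s : ℝ} (h : s ∈ jG q) : ∃ d ∈ jD, ∃ t ∈ jG q, s = d + q * t := by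
  obtain ⟨d, hd, rfl⟩ := h
  refine ⟨d 0, hd 0, _, ⟨fun j => d (j+1), fun j => hd _, rfl⟩, ?_⟩
  rw [(j_summable q0 q1 hd).tsum_eq_zero_add, ← tsum_mul_left]
  simp only [pow_zero, mul_one]
  congr 1
  exact tsum_congr fun j => by ring

lemma jG_compact {q : ℝ} (q0 : 0 < q) (q1 : q < 1) : IsCompact (jG q) := by
  have hD : IsCompact jD := by
    apply Set.Finite.isCompact
    unfold jD
    exact Set.toFinite _
  have hK : IsCompact (Set.pi univ fun _ : ℕ => jD) := isCompact_univ_pi fun _ => hD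
  have hc : ContinuousOn (fun d : ℕ → ℝ => ∑' j, d j * q ^ j) (Set.pi univ fun _ : ℕ => jD) := by
    refine continuousOn_tsum (u := fun j => 9/5 * q ^ j) (fun j => by fun_prop)
      ((summable_geometric_of_lt_one q0.le q1).mul_left (9/5)) ?_
    intro j d hd
    have := jD_bd (hd j (mem_univ j))
    have hp : 0 ≤ q ^ j := by positivity
    rw [Real.norm_of_nonneg (mul_nonneg this.1 hp)]
    exact mul_le_mul_of_nonneg_right this.2.1 hp
  convert hK.image_of_continuousOn hc using 1
  ext s
  constructor
  · rintro ⟨d, hd, rfl⟩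
    exact ⟨d, fun j _ => hd j, rfl⟩
  · rintro ⟨d, hd, rfl⟩
    exact ⟨d, fun j => hd j (mem_univ j), rfl⟩

lemma jG_change {q : ℝ} (q0 : 0 < q) (q1 : q < 1) {s : ℝ} (h : s ∈ jG q) (n : ℕ) :
    ∃ t ∈ jG q, t ≠ s ∧ |t - s| ≤ 9/5 * q ^ n := by
  obtain ⟨d, hd, rfl⟩ := h
  have : ∃ e ∈ jD, e ≠ d n := by
    by_cases h : d n = 0
    · exact ⟨1, by simp [jD], by rw [h]; norm_num⟩
    · exact ⟨0, by simp [jD], fun h' => h h'.symm⟩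
  obtain ⟨e, he, hne⟩ := this
  have hd' : ∀ j, Function.update d n e j ∈ jD := by
    intro j
    by_cases h : j = n
    · subst h; simpa using he
    · simpa [h] using hd j
  have hp : 0 < q ^ n := by positivity
  have hdiff : (∑' j, Function.update d n e j * q ^ j) - ∑' j, d j * q ^ j = (e - d n) * q ^ n := by
    rw [← (j_summable q0 q1 hd').tsum_sub (j_summable q0 q1 hd), tsum_eq_single n]
    · simp; ring
    · intro j hj
      simp [hj]
  refine ⟨_, ⟨_, hd', rfl⟩, ?_, ?_⟩
  · rw [← sub_ne_zero, hdiff]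
    exact mul_ne_zero (sub_ne_zero.2 hne) hp.ne'
  · rw [hdiff, abs_mul, abs_of_pos hp]
    refine mul_le_mul_of_nonneg_right ?_ hp.le
    have h1 := jD_bd he
    have h2 := jD_bd (hd n)
    rw [abs_le]; constructor <;> linarith

lemma jG_perfect {q : ℝ} (q0 : 0 < q) (q1 : q < 1) : Perfect (jG q) := by
  refine ⟨(jG_compact q0 q1).isClosed, ?_⟩
  intro s hs
  rw [accPt_iff_frequently]
  choose t ht hne hb using jG_change q0 q1 hs
  have hlim : Tendsto t atTop (𝓝 s) := by
    rw [tendsto_iff_norm_sub_tendsto_zero]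
    refine squeeze_zero (fun _ => norm_nonneg _) hb ?_
    simpa using (tendsto_pow_atTop_nhds_zero_of_lt_one q0.le q1).const_mul (9/5)
  exact hlim.frequently (Frequently.of_forall fun n => ⟨hne n, ht n⟩)

lemma jG_fill {q : ℝ} (q0 : 0 < q) (q1 : q < 1) {a b : ℝ} (H : ∀ x ∈ Icc a b, ∃ d ∈ jD, (x - d) / q ∈ Icc a b) :
    Icc a b ⊆ jG q := by
  intro x hx
  choose f hf hf' using H
  let X : ℕ → Icc a b := fun n => Nat.rec ⟨x, hx⟩ (fun _ y => ⟨_, hf' y.1 y.2⟩) n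
  let d : ℕ → ℝ := fun n => f (X n).1 (X n).2
  have hd : ∀ j, d j ∈ jD := fun j => hf _ _
  have hX : ∀ n, ((X (n+1)).1 : ℝ) = ((X n).1 - d n) / q := fun n => rfl
  have hsum : ∀ n, ∑ j ∈ Finset.range n, d j * q ^ j = x - (X n).1 * q ^ n := by
    intro n
    induction n with
    | zero => simp [X]
    | succ n ih =>
      rw [Finset.sum_range_succ, ih, hX, pow_succ]
      field_simp
      ring
  refine ⟨d, hd, ?_⟩
  have hq := tendsto_pow_atTop_nhds_zero_of_lt_one q0.le q1
  have h0 : Tendsto (fun n => ((X n).1 : ℝ) * q ^ n) atTop (𝓝 0) := by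
    refine squeeze_zero_norm (a := fun n => (|a| + |b|) * q ^ n) (fun n => ?_) ?_
    · rw [norm_mul, Real.norm_eq_abs, Real.norm_of_nonneg (by positivity : 0 ≤ q ^ n)]
      refine mul_le_mul_of_nonneg_right ?_ (by positivity)
      have h1 := (X n).2.1
      have h2 := (X n).2.2
      rw [abs_le]
      constructor
      · linarith [neg_abs_le a, abs_nonneg b]
      · linarith [le_abs_self b, abs_nonneg a]
    · simpa using hq.const_mul (|a| + |b|)
  have h1 := (j_summable q0 q1 hd).hasSum.tendsto_sum_nat
  have h2 : Tendsto (fun n => ∑ j ∈ Finset.range n, d j * q ^ j) atTop (𝓝 x) := by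
    simp only [hsum]
    simpa using h0.const_sub x
  exact tendsto_nhds_unique h2 h1

lemma jG_interior {q : ℝ} (q0 : 0 < q) (q1 : q < 1) (hq : 1/6 ≤ q) : (interior (jG q)).Nonempty := by
  obtain ⟨r, hr⟩ : ∃ r, r = (1 - q)⁻¹ := ⟨_, rfl⟩
  have hr1 : (1 - q) * r = 1 := by
    rw [hr]; exact mul_inv_cancel₀ (by linarith)
  have hr6 : 6/5 ≤ r := by nlinarith
  have hsub : Icc (2/5 * r) (7/5 * r) ⊆ jG q := by
    apply jG_fill q0 q1
    rintro x ⟨hx1, hx2⟩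
    have key : ∀ d ∈ jD, d + 2/5 * (r - 1) ≤ x → x ≤ d + 7/5 * (r - 1) →
        ∃ d ∈ jD, (x - d) / q ∈ Icc (2/5 * r) (7/5 * r) := by
      intro d hd h1 h2
      refine ⟨d, hd, ?_, ?_⟩
      · rw [le_div_iff₀ q0]; nlinarith
      · rw [div_le_iff₀ q0]; nlinarith
    by_cases h1 : x ≤ 2/5 + 7/5 * (r - 1)
    · exact key (2/5) (by simp [jD]) (by linarith) h1
    by_cases h2 : x ≤ 3/5 + 7/5 * (r - 1)
    · exact key (3/5) (by simp [jD]) (by linarith) h2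
    by_cases h3 : x ≤ 4/5 + 7/5 * (r - 1)
    · exact key (4/5) (by simp [jD]) (by linarith) h3
    by_cases h4 : x ≤ 1 + 7/5 * (r - 1)
    · exact key 1 (by simp [jD]) (by linarith) h4
    by_cases h5 : x ≤ 6/5 + 7/5 * (r - 1)
    · exact key (6/5) (by simp [jD]) (by linarith) h5
    · exact key (7/5) (by simp [jD]) (by linarith) (by linarith)
  refine Set.Nonempty.mono (interior_mono hsub) ?_
  rw [interior_Icc, nonempty_Ioo]
  linarith

lemma jG_gap {q : ℝ} (q0 : 0 < q) (q1 : q < 1) (n : ℕ) : ∀ s ∈ jG q, s < 2/5 * q ^ n → s ≤ 9/5 * (q * (1 - q)⁻¹) * q ^ n := by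
  induction n with
  | zero =>
    intro s hs h
    obtain ⟨d, hd, t, ht, rfl⟩ := jG_split q0 q1 hs
    have ht' := jG_bd q0 q1 ht
    have := mul_nonneg q0.le ht'.1
    rcases (jD_bd hd).2.2 with rfl | h'
    · nlinarith [mul_le_mul_of_nonneg_left ht'.2 q0.le]
    · simp at h; linarith
  | succ n ih =>
    intro s hs h
    obtain ⟨d, hd, t, ht, rfl⟩ := jG_split q0 q1 hs
    have ht' := jG_bd q0 q1 ht
    have := mul_nonneg q0.le ht'.1
    have hp : q ^ (n+1) ≤ 1 := pow_le_one₀ q0.le q1.le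
    rcases (jD_bd hd).2.2 with rfl | h'
    · have h3 : t < 2/5 * q ^ n := by
        rw [pow_succ] at h
        by_contra hc
        nlinarith
      have := mul_le_mul_of_nonneg_left (ih t ht h3) q0.le
      rw [pow_succ]
      linarith
    · linarith

lemma jG_pt (q : ℝ) (n : ℕ) : 2/5 * q ^ n ∈ jG q := by
  refine ⟨fun j => if j = n then 2/5 else 0, ?_, ?_⟩
  · intro j
    by_cases h : j = n <;> simp [jD, h]
  · rw [tsum_eq_single n]
    · simp
    · intro j hj; simp [hj]

lemma jG_not {q : ℝ} (q0 : 0 < q) (q1 : q < 1) (h2 : q * (1 - q)⁻¹ < 2/9) : ¬ IsFiniteUnionOfClosedIntervals (jG q) := by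
  rintro ⟨S, hS⟩
  have hmem : ∀ n : ℕ, ∃ p : S, 2/5 * q ^ n ∈ Icc p.1.1 p.1.2 := by
    intro n
    have := jG_pt q n
    rw [hS] at this
    simp only [mem_iUnion] at this
    obtain ⟨p, hp, h⟩ := this
    exact ⟨⟨p, hp⟩, h⟩
  choose p hp using hmem
  have main : ∀ m n : ℕ, m < n → p m = p n → False := by
    intro m n hmn he
    set c := 9/5 * (q * (1 - q)⁻¹) with hc
    have hinv : 1 ≤ (1 - q)⁻¹ := (one_le_inv₀ (by linarith)).2 (by linarith)
    have hc1 : q ≤ c := by nlinarith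
    have hc2 : c < 2/5 := by linarith
    have hpm : 0 < q ^ m := by positivity
    have hle : q ^ n ≤ q ^ m * q := by
      rw [← pow_succ]
      exact pow_le_pow_of_le_one q0.le q1.le hmn
    have hy : (c + 2/5) / 2 * q ^ m ∈ jG q := by
      rw [hS]
      simp only [mem_iUnion]
      refine ⟨(p m).1, (p m).2, ?_, ?_⟩
      · have := (hp n).1
        rw [← he] at this
        nlinarith
      · have := (hp m).2
        nlinarith
    have := jG_gap q0 q1 m _ hy (by nlinarith)
    nlinarith
  obtain ⟨m, n, hmn, he⟩ := Finite.exists_ne_map_eq_of_infinite p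
  rcases lt_or_gt_of_ne hmn with h | h
  · exact main m n h he
  · exact main n m h he.symm

/-- (Jones) For every `q` with `1/5 ≤ ∑_{i≥1} q^i < 2/9`, the achievement set of the
multigeometric sequence `(3/5, 2/5, 2/5, 2/5 ; q)` is a Cantorval. -/
theorem jones_cantorval (q : ℝ) (h1 : 1 / 5 ≤ ∑' i : ℕ, q ^ (i + 1))
    (h2 : ∑' i : ℕ, q ^ (i + 1) < 2 / 9) :
    IsCantorval (multigeomAchievementSet 4 ![3 / 5, 2 / 5, 2 / 5, 2 / 5] q) := by
  have hs : Summable fun i : ℕ => q ^ (i + 1) := by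
    by_contra h
    rw [tsum_eq_zero_of_not_summable h] at h1
    norm_num at h1
  have habs : |q| < 1 := by
    have := (summable_nat_add_iff (f := fun i : ℕ => q ^ i) 1).1 hs
    simpa using summable_geometric_iff_norm_lt_one.1 this
  have hlt := abs_lt.1 habs
  have hval : ∑' i : ℕ, q ^ (i + 1) = q * (1 - q)⁻¹ := by
    rw [← tsum_geometric_of_abs_lt_one habs, ← tsum_mul_left]
    exact tsum_congr fun i => by ring
  rw [hval] at h1 h2
  have hq6 : 1 / 6 ≤ q := by
    rw [← div_eq_mul_inv, le_div_iff₀ (by linarith)] at h1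
    linarith
  have q0 : 0 < q := by linarith
  rw [jE_eq]
  exact ⟨⟨_, jG_pt q 0⟩, jG_compact q0 hlt.2, jG_perfect q0 hlt.2,
    jG_interior q0 hlt.2 hq6, jG_not q0 hlt.2 h2⟩
end
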